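/- arXiv:2510.17707 — 6 statements merged into one kernel-verified Lean document; each statement's English description precedes it below -/
import Mathlib

section
/- Let p ≥ 5 be an integer. Let H_p be the group presented by generators V and A(i), B(i), C(i), D(i) for 1 ≤ i ≤ p−3, with relators: the commutators [A(i),B(j)], [B(i),C(j)], [C(i),D(j)], [D(i),A(j)] for all i,j ∈ {1,…,p−3} with i+j > p−3, together with V B(p−i−4) V⁻¹ C(i)⁻¹ and V A(p−i−4) V⁻¹ D(i)⁻¹ for 1 ≤ i ≤ p−5. Let G be the group presented by generators u, v, w and A_{1,i}, A_{2,i} for 2 ≤ i ≤ p−1, with relators [w⁻¹ A_{1,i} v, A_{1,j}] for 2 ≤ i < j ≤ p−1; [w⁻¹ A_{1,i} v, A_{2,j}] for 2 ≤ i ≤ p−2, 2 ≤ j ≤ p−i; [v A_{2,j} u, A_{2,i}] for 2 ≤ i < j ≤ p−1; and [v A_{2,j} u, A_{1,i}] for i,j ∈ {3,…,p−1} with i+j ≥ p+2. Then the assignment V ↦ v, A(i) ↦ α(i), B(i) ↦ β(i), C(i) ↦ γ(i), D(i) ↦ δ(i) — where, with the conventions A_{1,p} = 1 and A_{2,1}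 = 1, α(i) := A_{2,p−i−1} A_{2,p−i−2}⁻¹; β(p−3) := w⁻¹ A_{1,2} v and β(i) := v⁻¹ A_{1,p−i−2}⁻¹ A_{1,p−i−1} v for i ≤ p−4; γ(i) := A_{1,i+2}⁻¹ A_{1,i+3}; δ(p−3) := v A_{2,p−1} u and δ(i) := v A_{2,i+3} A_{2,i+2}⁻¹ v⁻¹ for i ≤ p−4 — extends to a well-defined group isomorphism θ : H_p → G. -/
/-- Generators of the presentation of `B(p,q)`: triples `(t, ℓ, i)` with `t ∈ Fin 3`
(`t = 0` for `a`, `t = 1` for `b`, `t = 2` for `c`), `1 ≤ ℓ ≤ q - 1`, `1 ≤ i ≤ p - 1`. -/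
def BGen (p q : ℕ) : Type :=
  {x : Fin 3 × ℕ × ℕ // 1 ≤ x.2.1 ∧ x.2.1 ≤ q - 1 ∧ 1 ≤ x.2.2 ∧ x.2.2 ≤ p - 1}

/-- The generator `a_{ℓ,i}` (as an element of the free group), or `1` if out of range. -/
def ga (p q ℓ i : ℕ) : FreeGroup (BGen p q) :=
  if h : 1 ≤ ℓ ∧ ℓ ≤ q - 1 ∧ 1 ≤ i ∧ i ≤ p - 1 then FreeGroup.of ⟨(0, ℓ, i), h⟩ else 1

/-- The generator `b_{ℓ,i}`, or `1` if out of range. -/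
def gb (p q ℓ i : ℕ) : FreeGroup (BGen p q) :=
  if h : 1 ≤ ℓ ∧ ℓ ≤ q - 1 ∧ 1 ≤ i ∧ i ≤ p - 1 then FreeGroup.of ⟨(1, ℓ, i), h⟩ else 1

/-- The generator `c_{ℓ,i}`, or `1` if out of range. -/
def gc (p q ℓ i : ℕ) : FreeGroup (BGen p q) :=
  if h : 1 ≤ ℓ ∧ ℓ ≤ q - 1 ∧ 1 ≤ i ∧ i ≤ p - 1 then FreeGroup.of ⟨(2, ℓ, i), h⟩ else 1

/-- The commutator `[x, y] = x * y * x⁻¹ * y⁻¹`. -/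
def gcomm {G : Type*} [Group G] (x y : G) : G := x * y * x⁻¹ * y⁻¹

/-- The relators (R1)–(R5) of the presentation of `B(p,q)`. -/
def Brels (p q : ℕ) : Set (FreeGroup (BGen p q)) :=
  {r | r = ga p q 1 1 ∨ r = gc p q (q - 1) 1
    ∨ (∃ ℓ i j, 1 ≤ ℓ ∧ ℓ ≤ q - 1 ∧ 1 ≤ i ∧ i < j ∧ j ≤ p - 1 ∧
        r = gb p q ℓ i * ga p q ℓ j * (gb p q ℓ i)⁻¹ * (gc p q ℓ j)⁻¹)
    ∨ (∃ ℓ i j, 1 ≤ ℓ ∧ ℓ ≤ q - 2 ∧ 1 ≤ i ∧ i ≤ p - 1 ∧ 1 ≤ j ∧ j ≤ p - i ∧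
        r = gc p q ℓ i * ga p q (ℓ + 1) j * (gb p q ℓ i)⁻¹ * (gb p q (ℓ + 1) j)⁻¹)
    ∨ (∃ ℓ i j, 1 ≤ ℓ ∧ ℓ ≤ q - 2 ∧ 3 ≤ i ∧ i ≤ p - 1 ∧ 3 ≤ j ∧ j ≤ p - 1 ∧ p + 2 ≤ i + j ∧
        r = gcomm (gc p q ℓ i) (ga p q (ℓ + 1) j))
    ∨ (∃ ℓ lam i j, 2 ≤ ℓ + 1 ∧ ℓ + 1 < lam ∧ lam ≤ q - 1 ∧
        1 ≤ i ∧ i ≤ p - 1 ∧ 1 ≤ j ∧ j ≤ p - 1 ∧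
        r = gcomm (gc p q ℓ i) (ga p q lam j))}

/-- The square-section braid group `B(p,q) = B_{pq-2}(p × q)`, via its presentation. -/
abbrev B (p q : ℕ) : Type := PresentedGroup (Brels p q)

/-- Generators of the presentation of `B(p,3)` from the paper's Section 5:
`Sum.inl 0 = u`, `Sum.inl 1 = v`, `Sum.inl 2 = w`, and `Sum.inr ⟨(k, i), _⟩ = A_{k+1,i}`
for `k ∈ Fin 2` and `2 ≤ i ≤ p - 1`. -/
def GGen (p : ℕ) : Type :=
  Fin 3 ⊕ {x : Fin 2 × ℕ // 2 ≤ x.2 ∧ x.2 ≤ p - 1}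

/-- The generator `u`. -/
def gu (p : ℕ) : FreeGroup (GGen p) := FreeGroup.of (Sum.inl 0)
/-- The generator `v`. -/
def gv (p : ℕ) : FreeGroup (GGen p) := FreeGroup.of (Sum.inl 1)
/-- The generator `w`. -/
def gw (p : ℕ) : FreeGroup (GGen p) := FreeGroup.of (Sum.inl 2)

/-- The generator `A_{1,i}`, with the convention that out-of-range indices
(in particular `A_{1,p}`) give `1`. -/
def gA1 (p i : ℕ) : FreeGroup (GGen p) :=
  if h : 2 ≤ i ∧ i ≤ p - 1 then FreeGroup.of (Sum.inr ⟨(0, i), h⟩) else 1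

/-- The generator `A_{2,i}`, with the convention that out-of-range indices
(in particular `A_{2,1}`) give `1`. -/
def gA2 (p i : ℕ) : FreeGroup (GGen p) :=
  if h : 2 ≤ i ∧ i ≤ p - 1 then FreeGroup.of (Sum.inr ⟨(1, i), h⟩) else 1

/-- The relators of the presentation of `B(p,3)` by generators `u, v, w, A_{1,i}, A_{2,i}`. -/
def Grels (p : ℕ) : Set (FreeGroup (GGen p)) :=
  {r | (∃ i j, 2 ≤ i ∧ i < j ∧ j ≤ p - 1 ∧
        r = gcomm ((gw p)⁻¹ * gA1 p i * gv p) (gA1 p j))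
    ∨ (∃ i j, 2 ≤ i ∧ i ≤ p - 2 ∧ 2 ≤ j ∧ j ≤ p - i ∧
        r = gcomm ((gw p)⁻¹ * gA1 p i * gv p) (gA2 p j))
    ∨ (∃ i j, 2 ≤ i ∧ i < j ∧ j ≤ p - 1 ∧
        r = gcomm (gv p * gA2 p j * gu p) (gA2 p i))
    ∨ (∃ i j, 3 ≤ i ∧ i ≤ p - 1 ∧ 3 ≤ j ∧ j ≤ p - 1 ∧ p + 2 ≤ i + j ∧
        r = gcomm (gv p * gA2 p j * gu p) (gA1 p i))}

/-- The word `α(i) = A_{2,p-i-1} A_{2,p-i-2}⁻¹` (convention `A_{2,1} = 1`). -/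
def walpha (p i : ℕ) : FreeGroup (GGen p) := gA2 p (p - i - 1) * (gA2 p (p - i - 2))⁻¹

/-- The word `β(i)`: `β(p-3) = w⁻¹ A_{1,2} v` and
`β(i) = v⁻¹ A_{1,p-i-2}⁻¹ A_{1,p-i-1} v` for `1 ≤ i ≤ p-4`. -/
def wbeta (p i : ℕ) : FreeGroup (GGen p) :=
  if i = p - 3 then (gw p)⁻¹ * gA1 p 2 * gv p
  else (gv p)⁻¹ * (gA1 p (p - i - 2))⁻¹ * gA1 p (p - i - 1) * gv p

/-- The word `γ(i) = A_{1,i+2}⁻¹ A_{1,i+3}` (convention `A_{1,p} = 1`). -/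
def wgamma (p i : ℕ) : FreeGroup (GGen p) := (gA1 p (i + 2))⁻¹ * gA1 p (i + 3)

/-- The word `δ(i)`: `δ(p-3) = v A_{2,p-1} u` and
`δ(i) = v A_{2,i+3} A_{2,i+2}⁻¹ v⁻¹` for `1 ≤ i ≤ p-4`. -/
def wdelta (p i : ℕ) : FreeGroup (GGen p) :=
  if i = p - 3 then gv p * gA2 p (p - 1) * gu p
  else gv p * gA2 p (i + 3) * (gA2 p (i + 2))⁻¹ * (gv p)⁻¹

/-- The relators `[α(i),β(j)]`, `[β(i),γ(j)]`, `[γ(i),δ(j)]`, `[δ(i),α(j)]` for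
`i, j ∈ {1, …, p-3}` with `i + j > p - 3`. -/
def ABCDrels (p : ℕ) : Set (FreeGroup (GGen p)) :=
  {r | ∃ i j, 1 ≤ i ∧ i ≤ p - 3 ∧ 1 ≤ j ∧ j ≤ p - 3 ∧ p - 3 < i + j ∧
      (r = gcomm (walpha p i) (wbeta p j) ∨ r = gcomm (wbeta p i) (wgamma p j)
        ∨ r = gcomm (wgamma p i) (wdelta p j) ∨ r = gcomm (wdelta p i) (walpha p j))}

/-- Generators of `H_p`: `Sum.inl () = V` and `Sum.inr ⟨(k, i), _⟩` with `k ∈ Fin 4`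
(`k = 0` for `A`, `k = 1` for `B`, `k = 2` for `C`, `k = 3` for `D`) and `1 ≤ i ≤ p - 3`. -/
def HGen (p : ℕ) : Type :=
  Unit ⊕ {x : Fin 4 × ℕ // 1 ≤ x.2 ∧ x.2 ≤ p - 3}

/-- The generator `V` of `H_p`. -/
def hV (p : ℕ) : FreeGroup (HGen p) := FreeGroup.of (Sum.inl ())

/-- The generator `A(i)`, `B(i)`, `C(i)` or `D(i)` of `H_p` (according to `k = 0,1,2,3`),
or `1` if `i` is out of range. -/
def hX (p : ℕ) (k : Fin 4) (i : ℕ) : FreeGroup (HGen p) :=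
  if h : 1 ≤ i ∧ i ≤ p - 3 then FreeGroup.of (Sum.inr ⟨(k, i), h⟩) else 1

/-- The relators of `H_p`: the commutators `[A(i),B(j)]`, `[B(i),C(j)]`, `[C(i),D(j)]`,
`[D(i),A(j)]` for `i, j ∈ {1,…,p-3}` with `i + j > p - 3`, together with
`V B(p-i-4) V⁻¹ C(i)⁻¹` and `V A(p-i-4) V⁻¹ D(i)⁻¹` for `1 ≤ i ≤ p - 5`. -/
def Hrels (p : ℕ) : Set (FreeGroup (HGen p)) :=
  {r | (∃ i j, 1 ≤ i ∧ i ≤ p - 3 ∧ 1 ≤ j ∧ j ≤ p - 3 ∧ p - 3 < i + j ∧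
        (r = gcomm (hX p 0 i) (hX p 1 j) ∨ r = gcomm (hX p 1 i) (hX p 2 j)
          ∨ r = gcomm (hX p 2 i) (hX p 3 j) ∨ r = gcomm (hX p 3 i) (hX p 0 j)))
    ∨ (∃ i, 1 ≤ i ∧ i ≤ p - 5 ∧
        (r = hV p * hX p 1 (p - i - 4) * (hV p)⁻¹ * (hX p 2 i)⁻¹
          ∨ r = hV p * hX p 0 (p - i - 4) * (hV p)⁻¹ * (hX p 3 i)⁻¹))}

/-- The group `H_p`. -/
abbrev Hgroup (p : ℕ) : Type := PresentedGroup (Hrels p)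

theorem gcomm_eq_one_iff {K : Type*} [Group K] {x y : K} : gcomm x y = 1 ↔ Commute x y :=
  commutatorElement_eq_one_iff_commute

theorem map_gcomm_eq_one_iff {K L : Type*} [Group K] [Group L] (f : K →* L) {x y : K} :
    f (gcomm x y) = 1 ↔ Commute (f x) (f y) := by
  rw [← gcomm_eq_one_iff]
  simp [gcomm]

/-- Elements of a group satisfying the relations `Grels p`, with `a i` and `b i` in the roles of
`A_{1,i}` and `A_{2,i}`. -/
structure GRelations {K : Type*} [Group K] (p : ℕ) (u v w : K) (a b : ℕ → K) : Prop where
  a_last : a p = 1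
  b_one : b 1 = 1
  a_a : ∀ i j, 2 ≤ i → i < j → j ≤ p - 1 → Commute (w⁻¹ * a i * v) (a j)
  a_b : ∀ i j, 2 ≤ i → i ≤ p - 2 → 2 ≤ j → j ≤ p - i → Commute (w⁻¹ * a i * v) (b j)
  b_b : ∀ i j, 2 ≤ i → i < j → j ≤ p - 1 → Commute (v * b j * u) (b i)
  b_a : ∀ i j, 3 ≤ i → i ≤ p - 1 → 3 ≤ j → j ≤ p - 1 → p + 2 ≤ i + j →
    Commute (v * b j * u) (a i)

/-- Elements of a group satisfying the relations `Hrels p`. -/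
structure HRelations {K : Type*} [Group K] (p : ℕ) (V : K) (A B C D : ℕ → K) : Prop where
  A_B : ∀ i j, 1 ≤ i → i ≤ p - 3 → 1 ≤ j → j ≤ p - 3 → p - 3 < i + j → Commute (A i) (B j)
  B_C : ∀ i j, 1 ≤ i → i ≤ p - 3 → 1 ≤ j → j ≤ p - 3 → p - 3 < i + j → Commute (B i) (C j)
  C_D : ∀ i j, 1 ≤ i → i ≤ p - 3 → 1 ≤ j → j ≤ p - 3 → p - 3 < i + j → Commute (C i) (D j)
  D_A : ∀ i j, 1 ≤ i → i ≤ p - 3 → 1 ≤ j → j ≤ p - 3 → p - 3 < i + j → Commute (D i) (A j)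
  conj_B : ∀ i, 1 ≤ i → i ≤ p - 5 → V * B (p - i - 4) * V⁻¹ = C i
  conj_A : ∀ i, 1 ≤ i → i ≤ p - 5 → V * A (p - i - 4) * V⁻¹ = D i

section Words

variable {K : Type*} [Group K] (p : ℕ)

/-- The word `α(i)` evaluated in a group. -/
def alphaVal (b : ℕ → K) (i : ℕ) : K := b (p - i - 1) * (b (p - i - 2))⁻¹

/-- The word `β(i)` evaluated in a group. -/
def betaVal (v w : K) (a : ℕ → K) (i : ℕ) : K :=
  if i = p - 3 then w⁻¹ * a 2 * v else v⁻¹ * (a (p - i - 2))⁻¹ * a (p - i - 1) * v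

/-- The word `γ(i)` evaluated in a group. -/
def gammaVal (a : ℕ → K) (i : ℕ) : K := (a (i + 2))⁻¹ * a (i + 3)

/-- The word `δ(i)` evaluated in a group. -/
def deltaVal (u v : K) (b : ℕ → K) (i : ℕ) : K :=
  if i = p - 3 then v * b (p - 1) * u else v * b (i + 3) * (b (i + 2))⁻¹ * v⁻¹

/-- The element `γ(i)` in terms of the generators of `H_p`, extended to `i = 0`. -/
def gammaExt (V : K) (B C : ℕ → K) (i : ℕ) : K := if i = 0 then V * B (p - 4) * V⁻¹ else C i

/-- The element `α(i)` in terms of the generators of `H_p`, extended to `i = 0`. -/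
def alphaExt (V : K) (A D : ℕ → K) (i : ℕ) : K := if i = 0 then V⁻¹ * D (p - 4) * V else A i

/-- The element `A_{1,p-m}` in terms of the generators of `H_p`. -/
def a1Rev (V : K) (B C : ℕ → K) : ℕ → K
  | 0 => 1
  | m + 1 => a1Rev V B C m * (gammaExt p V B C (p - m - 3))⁻¹

/-- The element `A_{1,i}` in terms of the generators of `H_p`. -/
def a1Val (V : K) (B C : ℕ → K) (i : ℕ) : K := a1Rev p V B C (p - i)

/-- The element `A_{2,i}` in terms of the generators of `H_p`. -/
def a2Val (V : K) (A D : ℕ → K) : ℕ → K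
  | 0 => 1
  | 1 => 1
  | k + 2 => alphaExt p V A D (p - k - 3) * a2Val V A D (k + 1)

/-- The element `u` in terms of the generators of `H_p`. -/
def uVal (V : K) (A D : ℕ → K) : K := (a2Val p V A D (p - 1))⁻¹ * V⁻¹ * D (p - 3)

/-- The element `w` in terms of the generators of `H_p`. -/
def wVal (V : K) (B C : ℕ → K) : K := a1Val p V B C 2 * V * (B (p - 3))⁻¹

end Words

namespace GRelations

variable {K : Type*} [Group K] {p : ℕ} {u v w : K} {a b : ℕ → K}

theorem commute_alphaVal (h : GRelations p u v w a b) {z : K} {i : ℕ} (hi : i ≤ p - 3)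
    (hp : 5 ≤ p) (hz : ∀ j, 2 ≤ j → j ≤ p - i - 1 → Commute z (b j)) :
    Commute z (alphaVal p b i) := by
  refine (hz _ (by omega) le_rfl).mul_right (Commute.inv_right ?_)
  obtain hi | hi : p - i - 2 = 1 ∨ 2 ≤ p - i - 2 := by omega
  · rw [hi, h.b_one]
    exact Commute.one_right z
  · exact hz _ hi (by omega)

theorem commute_gammaVal (h : GRelations p u v w a b) {z : K} {i : ℕ} (hi : i ≤ p - 3)
    (hp : 5 ≤ p) (hz : ∀ j, i + 2 ≤ j → j ≤ p - 1 → Commute z (a j)) :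
    Commute z (gammaVal a i) := by
  refine (hz _ le_rfl (by omega)).inv_right.mul_right ?_
  obtain hi | hi : i + 3 = p ∨ i + 3 ≤ p - 1 := by omega
  · rw [hi, h.a_last]
    exact Commute.one_right z
  · exact hz _ (by omega) hi

theorem commute_betaVal {z : K} {i : ℕ} (h1 : 1 ≤ i) (hi : i ≤ p - 3)
    (hz : ∀ j, 2 ≤ j → j ≤ p - i - 1 → Commute z (w⁻¹ * a j * v)) :
    Commute z (betaVal p v w a i) := by
  unfold betaVal
  split_ifs with h
  · exact hz 2 le_rfl (by omega)
  · have := (hz (p - i - 2) (by omega) (by omega)).inv_right.mul_right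
      (hz (p - i - 1) (by omega) le_rfl)
    simpa [mul_assoc] using this

theorem commute_deltaVal {z : K} {i : ℕ} (h1 : 1 ≤ i) (hi : i ≤ p - 3)
    (hz : ∀ j, i + 2 ≤ j → j ≤ p - 1 → Commute z (v * b j * u)) :
    Commute z (deltaVal p u v b i) := by
  unfold deltaVal
  split_ifs with h
  · exact hz (p - 1) (by omega) le_rfl
  · have := (hz (i + 3) (by omega) (by omega)).mul_right
      (hz (i + 2) (by omega) (by omega)).inv_right
    simpa [mul_assoc] using this

theorem hRelations (h : GRelations p u v w a b) (hp : 5 ≤ p) :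
    HRelations p v (alphaVal p b) (betaVal p v w a) (gammaVal a) (deltaVal p u v b) where
  A_B i j hi hi' hj hj' hij := commute_betaVal hj hj' fun k hk hk' ↦
    (h.commute_alphaVal hi' hp fun l hl hl' ↦
      h.a_b k l hk (by omega) hl (by omega)).symm
  B_C i j hi hi' hj hj' hij := h.commute_gammaVal hj' hp fun k hk hk' ↦
    (commute_betaVal hi hi' fun l hl hl' ↦ (h.a_a l k hl (by omega) hk').symm).symm
  C_D i j hi hi' hj hj' hij := commute_deltaVal hj hj' fun k hk hk' ↦
    (h.commute_gammaVal hi' hp fun l hl hl' ↦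
      h.b_a l k (by omega) hl' (by omega) hk' (by omega)).symm
  D_A i j hi hi' hj hj' hij := h.commute_alphaVal hj' hp fun k hk hk' ↦
    (commute_deltaVal hi hi' fun l hl hl' ↦ (h.b_b k l hk (by omega) hl').symm).symm
  conj_B i hi hi' := by
    rw [betaVal, if_neg (by omega), show p - (p - i - 4) - 2 = i + 2 by omega,
      show p - (p - i - 4) - 1 = i + 3 by omega, gammaVal]
    group
  conj_A i hi hi' := by
    rw [deltaVal, if_neg (by omega), alphaVal, show p - (p - i - 4) - 2 = i + 2 by omega,
      show p - (p - i - 4) - 1 = i + 3 by omega]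
    group

end GRelations

section Recursion

variable {K : Type*} [Group K] {p : ℕ} {V : K} {A B C D : ℕ → K}

theorem a1Val_eq_mul {i : ℕ} (hi : 2 ≤ i) (hi' : i + 1 ≤ p) :
    a1Val p V B C i = a1Val p V B C (i + 1) * (gammaExt p V B C (i - 2))⁻¹ := by
  rw [a1Val, a1Val, show p - i = (p - (i + 1)) + 1 by omega, a1Rev,
    show p - (p - (i + 1)) - 3 = i - 2 by omega]

theorem a1Val_last : a1Val p V B C p = 1 := by simp [a1Val, a1Rev]

theorem a2Val_eq_mul {i : ℕ} (hi : 1 ≤ i) :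
    a2Val p V A D (i + 1) = alphaExt p V A D (p - i - 2) * a2Val p V A D i := by
  obtain ⟨k, rfl⟩ := Nat.exists_eq_add_of_le' hi
  rw [a2Val, show p - (k + 1) - 2 = p - k - 3 by omega]

/-- A sequence satisfying the downward recursion that defines `a1Val` equals it. -/
theorem eq_a1Val {a : ℕ → K} (h_last : a p = 1)
    (h_step : ∀ i, 2 ≤ i → i + 1 ≤ p → a i = a (i + 1) * (gammaExt p V B C (i - 2))⁻¹)
    {i : ℕ} (hi : 2 ≤ i) (hi' : i ≤ p) : a1Val p V B C i = a i := by
  induction hi' using Nat.decreasingInduction with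
  | self => rw [a1Val_last, h_last]
  | of_succ k hk ih => rw [a1Val_eq_mul hi hk, h_step k hi hk, ih (by omega)]

/-- A sequence satisfying the upward recursion that defines `a2Val` equals it. -/
theorem eq_a2Val {b : ℕ → K} (h_one : b 1 = 1)
    (h_step : ∀ i, 1 ≤ i → i + 1 ≤ p - 1 → b (i + 1) = alphaExt p V A D (p - i - 2) * b i)
    {i : ℕ} (hi : 1 ≤ i) (hi' : i ≤ p - 1) : a2Val p V A D i = b i := by
  induction i, hi using Nat.le_induction with
  | base => rw [h_one, a2Val]
  | succ k hk ih => rw [a2Val_eq_mul hk, h_step k hk hi', ih (by omega)]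

theorem commute_a1Val {z : K} {i : ℕ} (hi : 3 ≤ i) (hi' : i ≤ p)
    (hz : ∀ j, i - 2 ≤ j → j ≤ p - 3 → Commute z (C j)) : Commute z (a1Val p V B C i) := by
  induction hi' using Nat.decreasingInduction with
  | self => simp [a1Val_last]
  | of_succ k hk ih =>
    rw [a1Val_eq_mul (by omega) hk, gammaExt, if_neg (by omega)]
    exact (ih (by omega) fun j hj ↦ hz j (by omega)).mul_right
      (hz _ le_rfl (by omega)).inv_right

theorem commute_a2Val {z : K} {i : ℕ} (hi : 1 ≤ i) (hi' : i ≤ p - 2)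
    (hz : ∀ j, p - i - 1 ≤ j → j ≤ p - 3 → Commute z (A j)) :
    Commute z (a2Val p V A D i) := by
  induction i, hi using Nat.le_induction with
  | base => simp [a2Val]
  | succ k hk ih =>
    rw [a2Val_eq_mul hk, alphaExt, if_neg (by omega)]
    exact (hz _ (by omega) (by omega)).mul_right
      (ih (by omega) fun j hj ↦ hz j (by omega))

end Recursion

namespace HRelations

variable {K : Type*} [Group K] {p : ℕ} {V : K} {A B C D : ℕ → K}

theorem conj_gammaExt (h : HRelations p V A B C D) {i : ℕ} (hi : i ≤ p - 5) :
    V⁻¹ * gammaExt p V B C i * V = B (p - i - 4) := by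
  unfold gammaExt
  split_ifs with h0
  · subst h0
    simp [mul_assoc]
  · rw [← h.conj_B i (by omega) hi]
    group

theorem conj_alphaExt (h : HRelations p V A B C D) {i : ℕ} (hi : 1 ≤ i) (hi' : i ≤ p - 4) :
    V * alphaExt p V A D (p - i - 4) * V⁻¹ = D i := by
  unfold alphaExt
  split_ifs with h0
  · rw [show i = p - 4 by omega]
    group
  · exact h.conj_A i hi (by omega)

theorem wVal_inv_mul (i : ℕ) : (wVal p V B C)⁻¹ * a1Val p V B C i * V =
    B (p - 3) * (V⁻¹ * (a1Val p V B C 2)⁻¹ * a1Val p V B C i * V) := by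
  rw [wVal]
  group

theorem commute_wVal (h : HRelations p V A B C D) {z : K} {i : ℕ} (hi : 2 ≤ i)
    (hi' : i ≤ p - 2) (hz : ∀ j, p - i - 1 ≤ j → j ≤ p - 3 → Commute z (B j)) :
    Commute z ((wVal p V B C)⁻¹ * a1Val p V B C i * V) := by
  induction i, hi using Nat.le_induction with
  | base =>
    rw [wVal_inv_mul]
    simpa using hz (p - 3) (by omega) le_rfl
  | succ k hk ih =>
    have key : (wVal p V B C)⁻¹ * a1Val p V B C (k + 1) * V =
        (wVal p V B C)⁻¹ * a1Val p V B C k * V * B (p - k - 2) := by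
      rw [show p - k - 2 = p - (k - 2) - 4 by omega, ← h.conj_gammaExt (by omega),
        a1Val_eq_mul hk (by omega)]
      group
    rw [key]
    exact (ih (by omega) fun j hj ↦ hz j (by omega)).mul_right (hz _ (by omega) (by omega))

theorem commute_uVal (h : HRelations p V A B C D) {z : K} {i : ℕ} (hi : 3 ≤ i)
    (hi' : i ≤ p - 1) (hz : ∀ j, i - 2 ≤ j → j ≤ p - 3 → Commute z (D j)) :
    Commute z (V * a2Val p V A D i * uVal p V A D) := by
  induction hi' using Nat.decreasingInduction with
  | self =>
    rw [uVal]
    simpa [mul_assoc] using hz (p - 3) (by omega) le_rfl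
  | of_succ k hk ih =>
    have key : V * a2Val p V A D k * uVal p V A D =
        (D (k - 2))⁻¹ * (V * a2Val p V A D (k + 1) * uVal p V A D) := by
      rw [← h.conj_alphaExt (i := k - 2) (by omega) (by omega), a2Val_eq_mul (by omega),
        show p - (k - 2) - 4 = p - k - 2 by omega]
      group
    rw [key]
    exact (hz _ le_rfl (by omega)).inv_right.mul_right
      (ih (by omega) fun j hj ↦ hz j (by omega))

theorem gRelations (h : HRelations p V A B C D) :
    GRelations p (uVal p V A D) V (wVal p V B C) (a1Val p V B C) (a2Val p V A D) where
  a_last := a1Val_last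
  b_one := by rw [a2Val]
  a_a i j hi hij hj := commute_a1Val (by omega) (by omega) fun k hk hk' ↦
    (h.commute_wVal hi (by omega) fun l hl hl' ↦
      (h.B_C l k (by omega) hl' (by omega) hk' (by omega)).symm).symm
  a_b i j hi hi' hj hij := commute_a2Val (by omega) (by omega) fun k hk hk' ↦
    (h.commute_wVal hi hi' fun l hl hl' ↦
      h.A_B k l (by omega) hk' (by omega) hl' (by omega)).symm
  b_b i j hi hij hj := commute_a2Val (by omega) (by omega) fun k hk hk' ↦
    (h.commute_uVal (by omega) hj fun l hl hl' ↦
      (h.D_A l k (by omega) hl' (by omega) hk' (by omega)).symm).symm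
  b_a i j hi hi' hj hj' hij := commute_a1Val hi (by omega) fun k hk hk' ↦
    (h.commute_uVal hj hj' fun l hl hl' ↦
      h.C_D k l (by omega) hk' (by omega) hl' (by omega)).symm

theorem alphaVal_a2Val {i : ℕ} (hi : 1 ≤ i) (hi' : i ≤ p - 3) :
    alphaVal p (a2Val p V A D) i = A i := by
  rw [alphaVal, show p - i - 1 = p - i - 2 + 1 by omega, a2Val_eq_mul (by omega),
    show p - (p - i - 2) - 2 = i by omega, alphaExt, if_neg (by omega), mul_inv_cancel_right]

theorem gammaVal_a1Val {i : ℕ} (hi : 1 ≤ i) (hi' : i ≤ p - 3) :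
    gammaVal (a1Val p V B C) i = C i := by
  rw [gammaVal, a1Val_eq_mul (by omega) (by omega), Nat.add_sub_cancel, gammaExt,
    if_neg (by omega)]
  group

theorem betaVal_a1Val (h : HRelations p V A B C D) {i : ℕ} (hi : 1 ≤ i) (hi' : i ≤ p - 3) :
    betaVal p V (wVal p V B C) (a1Val p V B C) i = B i := by
  unfold betaVal
  split_ifs with h3
  · rw [h3, wVal_inv_mul]
    group
  · rw [a1Val_eq_mul (i := p - i - 2) (by omega) (by omega),
      show p - i - 2 + 1 = p - i - 1 by omega]
    have := h.conj_gammaExt (i := p - i - 2 - 2) (by omega)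
    rw [show p - (p - i - 2 - 2) - 4 = i by omega] at this
    rw [← this]
    group

theorem deltaVal_a2Val (h : HRelations p V A B C D) {i : ℕ} (hi : 1 ≤ i) (hi' : i ≤ p - 3) :
    deltaVal p (uVal p V A D) V (a2Val p V A D) i = D i := by
  unfold deltaVal
  split_ifs with h3
  · rw [h3, uVal]
    group
  · rw [a2Val_eq_mul (i := i + 2) (by omega), ← h.conj_alphaExt hi (by omega),
      show p - (i + 2) - 2 = p - i - 4 by omega]
    group

end HRelations

section InverseWords

variable {K : Type*} [Group K] {p : ℕ} {u v w : K} {a b : ℕ → K}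

theorem gammaExt_betaVal (hp : 5 ≤ p) (i : ℕ) :
    gammaExt p v (betaVal p v w a) (gammaVal a) i = gammaVal a i := by
  unfold gammaExt
  split_ifs with h
  · rw [h, betaVal, if_neg (by omega), show p - (p - 4) - 2 = 2 by omega,
      show p - (p - 4) - 1 = 3 by omega, gammaVal]
    group
  · rfl

theorem alphaExt_deltaVal (hp : 5 ≤ p) (i : ℕ) :
    alphaExt p v (alphaVal p b) (deltaVal p u v b) i = alphaVal p b i := by
  unfold alphaExt
  split_ifs with h
  · rw [h, deltaVal, if_neg (by omega), alphaVal, show p - 4 + 3 = p - 0 - 1 by omega,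
      show p - 4 + 2 = p - 0 - 2 by omega]
    group
  · rfl

theorem a1Val_betaVal (hp : 5 ≤ p) (ha : a p = 1) {i : ℕ} (hi : 2 ≤ i) (hi' : i ≤ p) :
    a1Val p v (betaVal p v w a) (gammaVal a) i = a i := by
  refine eq_a1Val ha (fun j hj _ ↦ ?_) hi hi'
  obtain ⟨k, rfl⟩ := Nat.exists_eq_add_of_le' hj
  rw [gammaExt_betaVal hp, Nat.add_sub_cancel, gammaVal]
  group

theorem a2Val_deltaVal (hp : 5 ≤ p) (hb : b 1 = 1) {i : ℕ} (hi : 1 ≤ i) (hi' : i ≤ p - 1) :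
    a2Val p v (alphaVal p b) (deltaVal p u v b) i = b i := by
  refine eq_a2Val hb (fun j hj hj' ↦ ?_) hi hi'
  rw [alphaExt_deltaVal hp, alphaVal, show p - (p - j - 2) - 1 = j + 1 by omega,
    show p - (p - j - 2) - 2 = j by omega]
  group

theorem wVal_betaVal (hp : 5 ≤ p) (ha : a p = 1) :
    wVal p v (betaVal p v w a) (gammaVal a) = w := by
  rw [wVal, a1Val_betaVal hp ha le_rfl (by omega), betaVal, if_pos rfl]
  group

theorem uVal_deltaVal (hp : 5 ≤ p) (hb : b 1 = 1) :
    uVal p v (alphaVal p b) (deltaVal p u v b) = u := by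
  rw [uVal, a2Val_deltaVal hp hb (by omega) le_rfl, deltaVal, if_pos rfl]
  group

end InverseWords

section Naturality

variable {K L : Type*} [Group K] [Group L] {p : ℕ} (f : K →* L) {V : K} {A B C D : ℕ → K}
  {V' : L} {A' B' C' D' : ℕ → L}

theorem map_a1Val (hp : 5 ≤ p) (hV : f V = V')
    (hB : ∀ i, 1 ≤ i → i ≤ p - 3 → f (B i) = B' i)
    (hC : ∀ i, 1 ≤ i → i ≤ p - 3 → f (C i) = C' i) {i : ℕ} (hi : 2 ≤ i) (hi' : i ≤ p) :
    f (a1Val p V B C i) = a1Val p V' B' C' i := by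
  refine (eq_a1Val (a := fun i ↦ f (a1Val p V B C i)) ?_ (fun j hj hj' ↦ ?_) hi hi').symm
  · rw [a1Val_last, map_one]
  · rw [a1Val_eq_mul hj hj', map_mul, map_inv]
    congr 2
    unfold gammaExt
    split_ifs with h0
    · simp [hV, hB (p - 4) (by omega) (by omega)]
    · exact hC _ (by omega) (by omega)

theorem map_a2Val (hp : 5 ≤ p) (hV : f V = V')
    (hA : ∀ i, 1 ≤ i → i ≤ p - 3 → f (A i) = A' i)
    (hD : ∀ i, 1 ≤ i → i ≤ p - 3 → f (D i) = D' i) {i : ℕ} (hi : 1 ≤ i) (hi' : i ≤ p - 1) :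
    f (a2Val p V A D i) = a2Val p V' A' D' i := by
  refine (eq_a2Val (b := fun i ↦ f (a2Val p V A D i)) ?_ (fun j hj hj' ↦ ?_) hi hi').symm
  · rw [a2Val, map_one]
  · rw [a2Val_eq_mul hj, map_mul]
    congr 1
    unfold alphaExt
    split_ifs with h0
    · simp [hV, hD (p - 4) (by omega) (by omega)]
    · exact hA _ (by omega) (by omega)

theorem map_wVal (hp : 5 ≤ p) (hV : f V = V')
    (hB : ∀ i, 1 ≤ i → i ≤ p - 3 → f (B i) = B' i)
    (hC : ∀ i, 1 ≤ i → i ≤ p - 3 → f (C i) = C' i) :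
    f (wVal p V B C) = wVal p V' B' C' := by
  rw [wVal, wVal, map_mul, map_mul, map_inv, map_a1Val f hp hV hB hC le_rfl (by omega), hV,
    hB _ (by omega) le_rfl]

theorem map_uVal (hp : 5 ≤ p) (hV : f V = V')
    (hA : ∀ i, 1 ≤ i → i ≤ p - 3 → f (A i) = A' i)
    (hD : ∀ i, 1 ≤ i → i ≤ p - 3 → f (D i) = D' i) :
    f (uVal p V A D) = uVal p V' A' D' := by
  rw [uVal, uVal, map_mul, map_mul, map_inv, map_inv,
    map_a2Val f hp hV hA hD (by omega) le_rfl, hV, hD _ (by omega) le_rfl]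

end Naturality

section Homs

variable {K : Type*} [Group K] {p : ℕ}

theorem map_walpha (f : FreeGroup (GGen p) →* K) (i : ℕ) :
    f (walpha p i) = alphaVal p (fun j ↦ f (gA2 p j)) i := by
  simp [walpha, alphaVal]

theorem map_wbeta (f : FreeGroup (GGen p) →* K) (i : ℕ) :
    f (wbeta p i) = betaVal p (f (gv p)) (f (gw p)) (fun j ↦ f (gA1 p j)) i := by
  unfold wbeta betaVal
  split_ifs <;> simp

theorem map_wgamma (f : FreeGroup (GGen p) →* K) (i : ℕ) :
    f (wgamma p i) = gammaVal (fun j ↦ f (gA1 p j)) i := by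
  simp [wgamma, gammaVal]

theorem map_wdelta (f : FreeGroup (GGen p) →* K) (i : ℕ) :
    f (wdelta p i) = deltaVal p (f (gu p)) (f (gv p)) (fun j ↦ f (gA2 p j)) i := by
  unfold wdelta deltaVal
  split_ifs <;> simp

theorem gRelations_mk (hp : 5 ≤ p) :
    GRelations p (PresentedGroup.mk (Grels p) (gu p)) (PresentedGroup.mk (Grels p) (gv p))
      (PresentedGroup.mk (Grels p) (gw p)) (fun i ↦ PresentedGroup.mk (Grels p) (gA1 p i))
      (fun i ↦ PresentedGroup.mk (Grels p) (gA2 p i)) where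
  a_last := by
    rw [gA1, dif_neg (by omega), map_one]
  b_one := by
    rw [gA2, dif_neg (by omega), map_one]
  a_a i j hi hij hj := by
    simpa using (map_gcomm_eq_one_iff _).1 (PresentedGroup.one_of_mem (rels := Grels p)
      (.inl ⟨i, j, hi, hij, hj, rfl⟩))
  a_b i j hi hi' hj hij := by
    simpa using (map_gcomm_eq_one_iff _).1 (PresentedGroup.one_of_mem (rels := Grels p)
      (.inr (.inl ⟨i, j, hi, hi', hj, hij, rfl⟩)))
  b_b i j hi hij hj := by
    simpa using (map_gcomm_eq_one_iff _).1 (PresentedGroup.one_of_mem (rels := Grels p)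
      (.inr (.inr (.inl ⟨i, j, hi, hij, hj, rfl⟩))))
  b_a i j hi hi' hj hj' hij := by
    simpa using (map_gcomm_eq_one_iff _).1 (PresentedGroup.one_of_mem (rels := Grels p)
      (.inr (.inr (.inr ⟨i, j, hi, hi', hj, hj', hij, rfl⟩))))

theorem hRelations_mk :
    HRelations p (PresentedGroup.mk (Hrels p) (hV p))
      (fun i ↦ PresentedGroup.mk (Hrels p) (hX p 0 i))
      (fun i ↦ PresentedGroup.mk (Hrels p) (hX p 1 i))
      (fun i ↦ PresentedGroup.mk (Hrels p) (hX p 2 i))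
      (fun i ↦ PresentedGroup.mk (Hrels p) (hX p 3 i)) where
  A_B i j hi hi' hj hj' hij := (map_gcomm_eq_one_iff _).1 <| PresentedGroup.one_of_mem
    (.inl ⟨i, j, hi, hi', hj, hj', hij, .inl rfl⟩)
  B_C i j hi hi' hj hj' hij := (map_gcomm_eq_one_iff _).1 <| PresentedGroup.one_of_mem
    (.inl ⟨i, j, hi, hi', hj, hj', hij, .inr (.inl rfl)⟩)
  C_D i j hi hi' hj hj' hij := (map_gcomm_eq_one_iff _).1 <| PresentedGroup.one_of_mem
    (.inl ⟨i, j, hi, hi', hj, hj', hij, .inr (.inr (.inl rfl))⟩)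
  D_A i j hi hi' hj hj' hij := (map_gcomm_eq_one_iff _).1 <| PresentedGroup.one_of_mem
    (.inl ⟨i, j, hi, hi', hj, hj', hij, .inr (.inr (.inr rfl))⟩)
  conj_B i hi hi' := by
    have := PresentedGroup.one_of_mem (rels := Hrels p) (.inr ⟨i, hi, hi', .inl rfl⟩)
    simpa using mul_inv_eq_one.1 this
  conj_A i hi hi' := by
    have := PresentedGroup.one_of_mem (rels := Hrels p) (.inr ⟨i, hi, hi', .inr rfl⟩)
    simpa using mul_inv_eq_one.1 this

/-- The assignment on the generators of `H_p` with prescribed values. -/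
def hGenMap (p : ℕ) (V : K) (X : Fin 4 → ℕ → K) : HGen p → K :=
  Sum.elim (fun _ ↦ V) fun x ↦ X x.1.1 x.1.2

/-- The assignment on the generators of `G` with prescribed values. -/
def gGenMap (p : ℕ) (x : Fin 3 → K) (A : Fin 2 → ℕ → K) : GGen p → K :=
  Sum.elim x fun y ↦ A y.1.1 y.1.2

theorem lift_hV (V : K) (X : Fin 4 → ℕ → K) : FreeGroup.lift (hGenMap p V X) (hV p) = V := by
  exact FreeGroup.lift_apply_of

theorem lift_hX (V : K) (X : Fin 4 → ℕ → K) (k : Fin 4) {i : ℕ} (hi : 1 ≤ i)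
    (hi' : i ≤ p - 3) : FreeGroup.lift (hGenMap p V X) (hX p k i) = X k i := by
  rw [hX, dif_pos ⟨hi, hi'⟩]
  exact FreeGroup.lift_apply_of

theorem lift_gA1 (x : Fin 3 → K) (A : Fin 2 → ℕ → K) {i : ℕ} (hi : 2 ≤ i) (hi' : i ≤ p - 1) :
    FreeGroup.lift (gGenMap p x A) (gA1 p i) = A 0 i := by
  rw [gA1, dif_pos ⟨hi, hi'⟩]
  exact FreeGroup.lift_apply_of

theorem lift_gA2 (x : Fin 3 → K) (A : Fin 2 → ℕ → K) {i : ℕ} (hi : 2 ≤ i) (hi' : i ≤ p - 1) :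
    FreeGroup.lift (gGenMap p x A) (gA2 p i) = A 1 i := by
  rw [gA2, dif_pos ⟨hi, hi'⟩]
  exact FreeGroup.lift_apply_of

theorem lift_gu (x : Fin 3 → K) (A : Fin 2 → ℕ → K) :
    FreeGroup.lift (gGenMap p x A) (gu p) = x 0 := by
  exact FreeGroup.lift_apply_of

theorem lift_gv (x : Fin 3 → K) (A : Fin 2 → ℕ → K) :
    FreeGroup.lift (gGenMap p x A) (gv p) = x 1 := by
  exact FreeGroup.lift_apply_of

theorem lift_gw (x : Fin 3 → K) (A : Fin 2 → ℕ → K) :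
    FreeGroup.lift (gGenMap p x A) (gw p) = x 2 := by
  exact FreeGroup.lift_apply_of

/-- Elements satisfying the relations of `H_p` are the images of its generators under a
homomorphism. -/
theorem HRelations.exists_hom {V : K} {A B C D : ℕ → K} (h : HRelations p V A B C D) :
    ∃ f : Hgroup p →* K, f (PresentedGroup.mk (Hrels p) (hV p)) = V ∧
      (∀ i, 1 ≤ i → i ≤ p - 3 → f (PresentedGroup.mk (Hrels p) (hX p 0 i)) = A i) ∧
      (∀ i, 1 ≤ i → i ≤ p - 3 → f (PresentedGroup.mk (Hrels p) (hX p 1 i)) = B i) ∧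
      (∀ i, 1 ≤ i → i ≤ p - 3 → f (PresentedGroup.mk (Hrels p) (hX p 2 i)) = C i) ∧
      ∀ i, 1 ≤ i → i ≤ p - 3 → f (PresentedGroup.mk (Hrels p) (hX p 3 i)) = D i := by
  have hrel : ∀ r ∈ Hrels p, FreeGroup.lift (hGenMap p V ![A, B, C, D]) r = 1 := by
    rintro r (⟨i, j, hi, hi', hj, hj', hij, rfl | rfl | rfl | rfl⟩ | ⟨i, hi, hi', rfl | rfl⟩)
    · rw [map_gcomm_eq_one_iff, lift_hX _ _ _ hi hi', lift_hX _ _ _ hj hj']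
      exact h.A_B i j hi hi' hj hj' hij
    · rw [map_gcomm_eq_one_iff, lift_hX _ _ _ hi hi', lift_hX _ _ _ hj hj']
      exact h.B_C i j hi hi' hj hj' hij
    · rw [map_gcomm_eq_one_iff, lift_hX _ _ _ hi hi', lift_hX _ _ _ hj hj']
      exact h.C_D i j hi hi' hj hj' hij
    · rw [map_gcomm_eq_one_iff, lift_hX _ _ _ hi hi', lift_hX _ _ _ hj hj']
      exact h.D_A i j hi hi' hj hj' hij
    · rw [map_mul, map_mul, map_mul, map_inv, map_inv, lift_hV,
        lift_hX _ _ _ (by omega) (by omega), lift_hX _ _ _ hi (by omega), mul_inv_eq_one]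
      exact h.conj_B i hi hi'
    · rw [map_mul, map_mul, map_mul, map_inv, map_inv, lift_hV,
        lift_hX _ _ _ (by omega) (by omega), lift_hX _ _ _ hi (by omega), mul_inv_eq_one]
      exact h.conj_A i hi hi'
  exact ⟨PresentedGroup.toGroup hrel, lift_hV _ _,
    fun _ hi hi' ↦ lift_hX _ _ 0 hi hi', fun _ hi hi' ↦ lift_hX _ _ 1 hi hi',
    fun _ hi hi' ↦ lift_hX _ _ 2 hi hi', fun _ hi hi' ↦ lift_hX _ _ 3 hi hi'⟩

/-- Elements satisfying the relations of `G` are the images of its generators under a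
homomorphism. -/
theorem GRelations.exists_hom (hp : 5 ≤ p) {u v w : K} {a b : ℕ → K}
    (h : GRelations p u v w a b) :
    ∃ f : PresentedGroup (Grels p) →* K,
      f (PresentedGroup.mk (Grels p) (gu p)) = u ∧
      f (PresentedGroup.mk (Grels p) (gv p)) = v ∧
      f (PresentedGroup.mk (Grels p) (gw p)) = w ∧
      (∀ i, 2 ≤ i → i ≤ p → f (PresentedGroup.mk (Grels p) (gA1 p i)) = a i) ∧
      ∀ i, 1 ≤ i → i ≤ p - 1 → f (PresentedGroup.mk (Grels p) (gA2 p i)) = b i := by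
  have hrel : ∀ r ∈ Grels p, FreeGroup.lift (gGenMap p ![u, v, w] ![a, b]) r = 1 := by
    rintro r (⟨i, j, hi, hij, hj, rfl⟩ | ⟨i, j, hi, hi', hj, hij, rfl⟩ |
      ⟨i, j, hi, hij, hj, rfl⟩ | ⟨i, j, hi, hi', hj, hj', hij, rfl⟩) <;>
      rw [map_gcomm_eq_one_iff, map_mul, map_mul]
    · rw [map_inv, lift_gw, lift_gv, lift_gA1 _ _ hi (by omega), lift_gA1 _ _ (by omega) hj]
      exact h.a_a i j hi hij hj
    · rw [map_inv, lift_gw, lift_gv, lift_gA1 _ _ hi (by omega), lift_gA2 _ _ hj (by omega)]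
      exact h.a_b i j hi hi' hj hij
    · rw [lift_gu, lift_gv, lift_gA2 _ _ (by omega) hj, lift_gA2 _ _ hi (by omega)]
      exact h.b_b i j hi hij hj
    · rw [lift_gu, lift_gv, lift_gA2 _ _ (by omega) hj', lift_gA1 _ _ (by omega) hi']
      exact h.b_a i j hi hi' hj hj' hij
  refine ⟨PresentedGroup.toGroup hrel, lift_gu _ _, lift_gv _ _, lift_gw _ _,
    fun i hi hi' ↦ ?_, fun i hi hi' ↦ ?_⟩
  · obtain rfl | hip := eq_or_ne i p
    · rw [(gRelations_mk hp).a_last, map_one, h.a_last]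
    · exact lift_gA1 ![u, v, w] ![a, b] hi (by omega)
  · obtain rfl | hi1 := eq_or_ne i 1
    · rw [(gRelations_mk hp).b_one, map_one, h.b_one]
    · exact lift_gA2 ![u, v, w] ![a, b] (by omega) hi'

/-- Homomorphisms on `H_p` agreeing on the generators are equal. -/
theorem Hgroup.hom_ext {f g : Hgroup p →* K}
    (hV_eq : f (PresentedGroup.mk (Hrels p) (hV p)) = g (PresentedGroup.mk (Hrels p) (hV p)))
    (hX_eq : ∀ k i, 1 ≤ i → i ≤ p - 3 →
      f (PresentedGroup.mk (Hrels p) (hX p k i)) = g (PresentedGroup.mk (Hrels p) (hX p k i))) :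
    f = g := by
  refine PresentedGroup.ext ?_
  rintro (⟨⟩ | ⟨⟨k, i⟩, hi⟩)
  · exact hV_eq
  · have := hX_eq k i hi.1 hi.2
    rwa [hX, dif_pos hi] at this

/-- Homomorphisms on `G` agreeing on the generators are equal. -/
theorem Ggroup_hom_ext {f g : PresentedGroup (Grels p) →* K}
    (hu : f (PresentedGroup.mk (Grels p) (gu p)) = g (PresentedGroup.mk (Grels p) (gu p)))
    (hv : f (PresentedGroup.mk (Grels p) (gv p)) = g (PresentedGroup.mk (Grels p) (gv p)))
    (hw : f (PresentedGroup.mk (Grels p) (gw p)) = g (PresentedGroup.mk (Grels p) (gw p)))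
    (ha : ∀ i, 2 ≤ i → i ≤ p - 1 →
      f (PresentedGroup.mk (Grels p) (gA1 p i)) = g (PresentedGroup.mk (Grels p) (gA1 p i)))
    (hb : ∀ i, 2 ≤ i → i ≤ p - 1 →
      f (PresentedGroup.mk (Grels p) (gA2 p i)) = g (PresentedGroup.mk (Grels p) (gA2 p i))) :
    f = g := by
  refine PresentedGroup.ext ?_
  rintro (k | ⟨⟨k, i⟩, hi⟩)
  · fin_cases k
    exacts [hu, hv, hw]
  · fin_cases k
    · have := ha i hi.1 hi.2
      rwa [gA1, dif_pos hi] at this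
    · have := hb i hi.1 hi.2
      rwa [gA2, dif_pos hi] at this

end Homs

/-- **Theorem θ.**
For `p ≥ 5`, the assignment `V ↦ v`, `A(i) ↦ α(i)`, `B(i) ↦ β(i)`, `C(i) ↦ γ(i)`,
`D(i) ↦ δ(i)` extends to a well-defined group isomorphism `θ : H_p → G`, where `G` is
the group presented by the relators `Grels p`. -/
theorem theta_isomorphism (p : ℕ) (hp : 5 ≤ p) :
    ∃ θ : Hgroup p ≃* PresentedGroup (Grels p),
      θ (PresentedGroup.mk (Hrels p) (hV p)) = PresentedGroup.mk (Grels p) (gv p) ∧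
      ∀ i, 1 ≤ i → i ≤ p - 3 →
        θ (PresentedGroup.mk (Hrels p) (hX p 0 i)) = PresentedGroup.mk (Grels p) (walpha p i) ∧
        θ (PresentedGroup.mk (Hrels p) (hX p 1 i)) = PresentedGroup.mk (Grels p) (wbeta p i) ∧
        θ (PresentedGroup.mk (Hrels p) (hX p 2 i)) = PresentedGroup.mk (Grels p) (wgamma p i) ∧
        θ (PresentedGroup.mk (Hrels p) (hX p 3 i)) = PresentedGroup.mk (Grels p) (wdelta p i) := by
  have hG := gRelations_mk hp
  have hH := hRelations_mk (p := p)
  obtain ⟨θ, hθV, hθA, hθB, hθC, hθD⟩ := (hG.hRelations hp).exists_hom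
  obtain ⟨ψ, hψu, hψv, hψw, hψa, hψb⟩ := hH.gRelations.exists_hom hp
  have hψθ : ψ.comp θ = MonoidHom.id _ := by
    refine Hgroup.hom_ext (by rw [MonoidHom.comp_apply, hθV, hψv, MonoidHom.id_apply])
      fun k i hi hi' ↦ ?_
    rw [MonoidHom.comp_apply, MonoidHom.id_apply]
    match k with
    | 0 =>
      rw [hθA i hi hi', alphaVal, map_mul, map_inv, hψb (p - i - 1) (by omega) (by omega),
        hψb (p - i - 2) (by omega) (by omega)]
      exact HRelations.alphaVal_a2Val (A := fun i ↦ PresentedGroup.mk _ (hX p 0 i)) hi hi'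
    | 1 =>
      refine .trans ?_ (hH.betaVal_a1Val hi hi')
      rw [hθB i hi hi', betaVal, betaVal]
      split_ifs with h
      · rw [map_mul, map_mul, map_inv, hψv, hψw, hψa 2 le_rfl (by omega)]
      · rw [map_mul, map_mul, map_mul, map_inv, map_inv, hψv,
          hψa (p - i - 1) (by omega) (by omega), hψa (p - i - 2) (by omega) (by omega)]
    | 2 =>
      rw [hθC i hi hi', gammaVal, map_mul, map_inv, hψa (i + 2) (by omega) (by omega),
        hψa (i + 3) (by omega) (by omega)]
      exact HRelations.gammaVal_a1Val (C := fun i ↦ PresentedGroup.mk _ (hX p 2 i)) hi hi'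
    | 3 =>
      refine .trans ?_ (hH.deltaVal_a2Val hi hi')
      rw [hθD i hi hi', deltaVal, deltaVal]
      split_ifs with h
      · rw [map_mul, map_mul, hψv, hψu, hψb (p - 1) (by omega) le_rfl]
      · rw [map_mul, map_mul, map_mul, map_inv, map_inv, hψv,
          hψb (i + 3) (by omega) (by omega), hψb (i + 2) (by omega) (by omega)]
  have hθψ : θ.comp ψ = MonoidHom.id _ := by
    refine Ggroup_hom_ext ?_ ?_ ?_ (fun i hi hi' ↦ ?_) fun i hi hi' ↦ ?_ <;>
      rw [MonoidHom.comp_apply, MonoidHom.id_apply]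
    · rw [hψu]
      exact (map_uVal θ hp hθV hθA hθD).trans (uVal_deltaVal hp hG.b_one)
    · rw [hψv, hθV]
    · rw [hψw]
      exact (map_wVal θ hp hθV hθB hθC).trans (wVal_betaVal hp hG.a_last)
    · rw [hψa i hi (by omega)]
      exact (map_a1Val θ hp hθV hθB hθC hi (by omega)).trans
        (a1Val_betaVal hp hG.a_last hi (by omega))
    · rw [hψb i (by omega) hi']
      exact (map_a2Val θ hp hθV hθA hθD (by omega) hi').trans
        (a2Val_deltaVal hp hG.b_one (by omega) hi')
  refine ⟨MonoidHom.toMulEquiv θ ψ hψθ hθψ, hθV, fun i hi hi' ↦ ⟨?_, ?_, ?_, ?_⟩⟩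
  · rw [map_walpha]
    exact hθA i hi hi'
  · rw [map_wbeta]
    exact hθB i hi hi'
  · rw [map_wgamma]
    exact hθC i hi hi'
  · rw [map_wdelta]
    exact hθD i hi hi'
end

section
/- Let p ≥ 5 be an integer, and let H_p be the group presented by generators V and A(i), B(i), C(i), D(i) for 1 ≤ i ≤ p−3, with relators the commutators [A(i),B(j)], [B(i),C(j)], [C(i),D(j)], [D(i),A(j)] for all i,j ∈ {1,…,p−3} with i+j > p−3, together with V B(p−i−4) V⁻¹ C(i)⁻¹ and V A(p−i−4) V⁻¹ D(i)⁻¹ for 1 ≤ i ≤ p−5. Then H_p is isomorphic to the group presented by generators x_i, x'_i, y'_i, y_i for 1 ≤ i ≤ p−3 together with one further generator t, and relators: the commutators [x_i, x'_j], [x'_i, y'_j], [y'_i, y_j], [y_i, x_j] for all i,j ∈ {1,…,p−3} with i+j > p−3; the commutators [x_i, x'_j] and [y'_i, y_j] for all i,j with i+j < p−5; and the relators t x_i t⁻¹ y_{p−i−4}⁻¹ and t x'_i t⁻¹ (y'_{p−i−4})⁻¹ for 1 ≤ i ≤ p−5. (The latter is the standard presentation of the HNN extension RAAG(S_{p−3})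 ∗ φ_p of the right-angled Artin group of the graph S_{p−3}, with stable letter t and with φ_p sending x_i ↦ y_{p−i−4} and x'_i ↦ y'_{p−i−4}.) -/
/-- Generators of the HNN-extension presentation of `RAAG(S_{p-3}) ∗ φ_p`:
`Sum.inl () = t` (the stable letter) and `Sum.inr ⟨(k, i), _⟩` with `k ∈ Fin 4`
(`k = 0` for `x`, `k = 1` for `x'`, `k = 2` for `y'`, `k = 3` for `y`), `1 ≤ i ≤ p - 3`. -/
def SGen (p : ℕ) : Type :=
  Unit ⊕ {x : Fin 4 × ℕ // 1 ≤ x.2 ∧ x.2 ≤ p - 3}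

/-- The stable letter `t`. -/
def st (p : ℕ) : FreeGroup (SGen p) := FreeGroup.of (Sum.inl ())

/-- The generator `x_i`, `x'_i`, `y'_i` or `y_i` (according to `k = 0,1,2,3`),
or `1` if `i` is out of range. -/
def sX (p : ℕ) (k : Fin 4) (i : ℕ) : FreeGroup (SGen p) :=
  if h : 1 ≤ i ∧ i ≤ p - 3 then FreeGroup.of (Sum.inr ⟨(k, i), h⟩) else 1

/-- The relators of the standard presentation of the HNN extension
`RAAG(S_{p-3}) ∗ φ_p`: the RAAG relators of the graph `S_{p-3}` (commutators
`[x_i,x'_j]`, `[x'_i,y'_j]`, `[y'_i,y_j]`, `[y_i,x_j]` for `i + j > p - 3`, and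
`[x_i,x'_j]`, `[y'_i,y_j]` for `i + j < p - 5`), together with the HNN relators
`t x_i t⁻¹ y_{p-i-4}⁻¹` and `t x'_i t⁻¹ y'_{p-i-4}⁻¹` for `1 ≤ i ≤ p - 5`. -/
def Srels (p : ℕ) : Set (FreeGroup (SGen p)) :=
  {r | (∃ i j, 1 ≤ i ∧ i ≤ p - 3 ∧ 1 ≤ j ∧ j ≤ p - 3 ∧ p - 3 < i + j ∧
        (r = gcomm (sX p 0 i) (sX p 1 j) ∨ r = gcomm (sX p 1 i) (sX p 2 j)
          ∨ r = gcomm (sX p 2 i) (sX p 3 j) ∨ r = gcomm (sX p 3 i) (sX p 0 j)))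
    ∨ (∃ i j, 1 ≤ i ∧ i ≤ p - 3 ∧ 1 ≤ j ∧ j ≤ p - 3 ∧ i + j < p - 5 ∧
        (r = gcomm (sX p 0 i) (sX p 1 j) ∨ r = gcomm (sX p 2 i) (sX p 3 j)))
    ∨ (∃ i, 1 ≤ i ∧ i ≤ p - 5 ∧
        (r = st p * sX p 0 i * (st p)⁻¹ * (sX p 3 (p - i - 4))⁻¹
          ∨ r = st p * sX p 1 i * (st p)⁻¹ * (sX p 2 (p - i - 4))⁻¹))}

lemma gcomm_mem_iff_commute {G : Type*} [Group G] (N : Subgroup G) [N.Normal] (a b : G) :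
    gcomm a b ∈ N ↔ Commute (a : G ⧸ N) (b : G ⧸ N) := by
  rw [← QuotientGroup.eq_one_iff, ← commutatorElement_eq_one_iff_commute]
  rfl

lemma conj_mem_iff_conj_eq {G : Type*} [Group G] (N : Subgroup G) [N.Normal] (t a c : G) :
    t * a * t⁻¹ * c⁻¹ ∈ N ↔ (t : G ⧸ N) * a * (t : G ⧸ N)⁻¹ = c := by
  rw [← QuotientGroup.eq_one_iff, ← mul_inv_eq_one (b := (c : G ⧸ N))]
  rfl

/-- Modulo a normal subgroup, a pair commutes if and only if its simultaneous conjugate does. -/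
lemma gcomm_mem_iff_of_conj_mem {G : Type*} [Group G] {N : Subgroup G} [N.Normal] {t a b c d : G}
    (hac : t * a * t⁻¹ * c⁻¹ ∈ N) (hbd : t * b * t⁻¹ * d⁻¹ ∈ N) :
    gcomm a b ∈ N ↔ gcomm d c ∈ N := by
  rw [conj_mem_iff_conj_eq] at hac hbd
  rw [gcomm_mem_iff_commute, gcomm_mem_iff_commute, ← hac, ← hbd, Commute.conj_iff]
  exact Commute.symm_iff

/-- The two generating sets have the same underlying type, and under this identification
the relators of `H_p` and of the HNN presentation have the same normal closure. -/
lemma normalClosure_Hrels_eq (p : ℕ) :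
    Subgroup.normalClosure (Hrels p) =
      (Subgroup.normalClosure (Srels p) : Subgroup (FreeGroup (SGen p))) := by
  apply le_antisymm
  · refine Subgroup.normalClosure_mono ?_
    rintro r (h | ⟨i, hi, hip, h⟩)
    · exact Or.inl h
    · refine Or.inr (Or.inr ⟨p - i - 4, by omega, by omega, ?_⟩)
      rw [show p - (p - i - 4) - 4 = i by omega]
      exact h.symm
  · set N : Subgroup (FreeGroup (HGen p)) := Subgroup.normalClosure (Hrels p)
    have comm_mem {r} (i j : ℕ) (hi : 1 ≤ i ∧ i ≤ p - 3) (hj : 1 ≤ j ∧ j ≤ p - 3)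
        (hij : p - 3 < i + j)
        (h : r = gcomm (hX p 0 i) (hX p 1 j) ∨ r = gcomm (hX p 1 i) (hX p 2 j)
          ∨ r = gcomm (hX p 2 i) (hX p 3 j) ∨ r = gcomm (hX p 3 i) (hX p 0 j)) : r ∈ N :=
      Subgroup.subset_normalClosure (Or.inl ⟨i, j, hi.1, hi.2, hj.1, hj.2, hij, h⟩)
    have conj_mem {r} (i : ℕ) (hi : 1 ≤ i) (hip : i ≤ p - 5)
        (h : r = hV p * hX p 1 i * (hV p)⁻¹ * (hX p 2 (p - i - 4))⁻¹
          ∨ r = hV p * hX p 0 i * (hV p)⁻¹ * (hX p 3 (p - i - 4))⁻¹) : r ∈ N := by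
      refine Subgroup.subset_normalClosure (Or.inr ⟨p - i - 4, by omega, by omega, ?_⟩)
      rwa [show p - (p - i - 4) - 4 = i by omega]
    have key (i j : ℕ) (hi : 1 ≤ i) (hip : i ≤ p - 5) (hj : 1 ≤ j) (hjp : j ≤ p - 5) :
        gcomm (hX p 0 i) (hX p 1 j) ∈ N ↔
          gcomm (hX p 2 (p - j - 4)) (hX p 3 (p - i - 4)) ∈ N :=
      gcomm_mem_iff_of_conj_mem (conj_mem i hi hip (Or.inr rfl)) (conj_mem j hj hjp (Or.inl rfl))
    refine Subgroup.normalClosure_le_normal (N := N) ?_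
    rintro r (⟨i, j, hi, hip, hj, hjp, hij, h⟩ | ⟨i, j, hi, hip, hj, hjp, hij, rfl | rfl⟩ |
      ⟨i, hi, hip, h⟩)
    · exact comm_mem i j ⟨hi, hip⟩ ⟨hj, hjp⟩ hij h
    · refine (key i j hi (by omega) hj (by omega)).2 ?_
      exact comm_mem (p - j - 4) (p - i - 4) (by omega) (by omega) (by omega)
        (Or.inr (Or.inr (Or.inl rfl)))
    · have h := (key (p - j - 4) (p - i - 4) (by omega) (by omega) (by omega) (by omega)).1
        (comm_mem _ _ (by omega) (by omega) (by omega) (Or.inl rfl))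
      rwa [show p - (p - i - 4) - 4 = i by omega, show p - (p - j - 4) - 4 = j by omega] at h
    · exact conj_mem i hi hip h.symm

/-- **Theorem (`H_p` is an HNN extension of a RAAG).**
For `p ≥ 5`, the group `H_p` is isomorphic to the HNN extension
`RAAG(S_{p-3}) ∗ φ_p`, given by its standard presentation. -/
theorem Hgroup_iso_HNN_RAAG (p : ℕ) (hp : 5 ≤ p) :
    Nonempty (Hgroup p ≃* PresentedGroup (Srels p)) := by
  exact ⟨@QuotientGroup.quotientMulEquivOfEq (FreeGroup (SGen p)) _
    (Subgroup.normalClosure (Hrels p)) (Subgroup.normalClosure (Srels p))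
    (Subgroup.normalClosure_normal (G := FreeGroup (HGen p))) Subgroup.normalClosure_normal
    (normalClosure_Hrels_eq p)⟩
end

section
/- Let p ≥ 5 be an integer, and let H_p be the group presented by generators V and A(i), B(i), C(i), D(i) for 1 ≤ i ≤ p−3, with relators the commutators [A(i),B(j)], [B(i),C(j)], [C(i),D(j)], [D(i),A(j)] for all i,j ∈ {1,…,p−3} with i+j > p−3, together with V B(p−i−4) V⁻¹ C(i)⁻¹ and V A(p−i−4) V⁻¹ D(i)⁻¹ for 1 ≤ i ≤ p−5. Then for all i,j ∈ {1,…,p−5} with i+j < p−5, the element A(i) commutes with B(j) in H_p, and the element C(i) commutes with D(j) in H_p. -/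
/-- If `[x, y]` is a relator, then `x` and `y` commute in the presented group. -/
theorem commute_mk_of_gcomm_mem {α : Type*} {rels : Set (FreeGroup α)} {x y : FreeGroup α}
    (h : gcomm x y ∈ rels) :
    Commute (PresentedGroup.mk rels x) (PresentedGroup.mk rels y) := by
  have h1 := PresentedGroup.one_of_mem h
  simp only [gcomm, map_mul, map_inv] at h1
  exact mul_inv_eq_iff_eq_mul.mp (mul_inv_eq_one.mp h1)

/-- If `v x v⁻¹ y⁻¹` is a relator, then `y = v x v⁻¹` in the presented group. -/
theorem mk_eq_conj_of_mem {α : Type*} {rels : Set (FreeGroup α)} {v x y : FreeGroup α}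
    (h : v * x * v⁻¹ * y⁻¹ ∈ rels) :
    PresentedGroup.mk rels y =
      PresentedGroup.mk rels v * PresentedGroup.mk rels x * (PresentedGroup.mk rels v)⁻¹ := by
  have h1 := PresentedGroup.one_of_mem h
  simp only [map_mul, map_inv] at h1
  exact (mul_inv_eq_one.mp h1).symm

/-- Conjugation by `V` reduces commutation of `C(i)` and `D(j)` to that of `A(p-j-4)` and
`B(p-i-4)`. -/
theorem commute_C_D_iff {p i j : ℕ} (hi1 : 1 ≤ i) (hi2 : i ≤ p - 5) (hj1 : 1 ≤ j)
    (hj2 : j ≤ p - 5) :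
    Commute (PresentedGroup.mk (Hrels p) (hX p 2 i)) (PresentedGroup.mk (Hrels p) (hX p 3 j)) ↔
      Commute (PresentedGroup.mk (Hrels p) (hX p 0 (p - j - 4)))
        (PresentedGroup.mk (Hrels p) (hX p 1 (p - i - 4))) := by
  have hC := mk_eq_conj_of_mem (rels := Hrels p) (Or.inr ⟨i, hi1, hi2, Or.inl rfl⟩)
  have hD := mk_eq_conj_of_mem (rels := Hrels p) (Or.inr ⟨j, hj1, hj2, Or.inr rfl⟩)
  rw [hC, hD, Commute.conj_iff]
  exact ⟨Commute.symm, Commute.symm⟩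

/-- **Lemma (forced commutation relations in `H_p`).**
For `p ≥ 5` and all `i, j ∈ {1,…,p-5}` with `i + j < p - 5`, the element `A(i)` commutes
with `B(j)` in `H_p`, and the element `C(i)` commutes with `D(j)` in `H_p`. -/
theorem forced_commutations (p : ℕ) (hp : 5 ≤ p) (i j : ℕ)
    (hi1 : 1 ≤ i) (hi2 : i ≤ p - 5) (hj1 : 1 ≤ j) (hj2 : j ≤ p - 5)
    (hij : i + j < p - 5) :
    Commute (PresentedGroup.mk (Hrels p) (hX p 0 i)) (PresentedGroup.mk (Hrels p) (hX p 1 j)) ∧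
    Commute (PresentedGroup.mk (Hrels p) (hX p 2 i)) (PresentedGroup.mk (Hrels p) (hX p 3 j)) := by
  constructor
  · have h := (commute_C_D_iff (p := p) (i := p - j - 4) (j := p - i - 4)
      (by omega) (by omega) (by omega) (by omega)).mp
      (commute_mk_of_gcomm_mem (Or.inl ⟨_, _, by omega, by omega, by omega, by omega, by omega,
        Or.inr (Or.inr (Or.inl rfl))⟩))
    rwa [show p - (p - i - 4) - 4 = i by omega, show p - (p - j - 4) - 4 = j by omega] at h
  · exact (commute_C_D_iff hi1 hi2 hj1 hj2).mpr
      (commute_mk_of_gcomm_mem (Or.inl ⟨_, _, by omega, by omega, by omega, by omega, by omega,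
        Or.inl rfl⟩))
end

section
/- Let G be a group and k ≥ 3 an integer. Let a_1, a_2, …, a_{k−1} and b_2, b_3, …, b_k be elements of G with a_1 = 1 and b_k = 1. For each 2 ≤ i ≤ k−1, suppose A_i is an element of the set {a_i^ε : ε ∈ {1,−1}} ∪ {a_{i−1}^ε a_i^{ε'} : ε,ε' ∈ {1,−1}} ∪ {a_i^ε a_{i−1}^{ε'} : ε,ε' ∈ {1,−1}}, and B_i is an element of the set {b_i^ε : ε ∈ {1,−1}} ∪ {b_{i+1}^ε b_i^{ε'} : ε,ε' ∈ {1,−1}} ∪ {b_i^ε b_{i+1}^{ε'} : ε,ε' ∈ {1,−1}}. Then a_i commutes with b_j for all 2 ≤ i < j ≤ k−1 if and only if A_i commutes with B_j for all 2 ≤ i < j ≤ k−1. -/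
/-- The allowed choices for `A_i`: an element of
`{a_i^{±1}} ∪ {a_{i-1}^{±1} a_i^{±1}} ∪ {a_i^{±1} a_{i-1}^{±1}}`. -/
def ChoiceA {G : Type*} [Group G] (a : ℕ → G) (i : ℕ) : Set G :=
  {x | (∃ ε : ℤ, (ε = 1 ∨ ε = -1) ∧ x = a i ^ ε)
    ∨ (∃ ε ε' : ℤ, (ε = 1 ∨ ε = -1) ∧ (ε' = 1 ∨ ε' = -1) ∧ x = a (i - 1) ^ ε * a i ^ ε')
    ∨ (∃ ε ε' : ℤ, (ε = 1 ∨ ε = -1) ∧ (ε' = 1 ∨ ε' = -1) ∧ x = a i ^ ε * a (i - 1) ^ ε')}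

/-- The allowed choices for `B_i`: an element of
`{b_i^{±1}} ∪ {b_{i+1}^{±1} b_i^{±1}} ∪ {b_i^{±1} b_{i+1}^{±1}}`. -/
def ChoiceB {G : Type*} [Group G] (b : ℕ → G) (i : ℕ) : Set G :=
  {x | (∃ ε : ℤ, (ε = 1 ∨ ε = -1) ∧ x = b i ^ ε)
    ∨ (∃ ε ε' : ℤ, (ε = 1 ∨ ε = -1) ∧ (ε' = 1 ∨ ε' = -1) ∧ x = b (i + 1) ^ ε * b i ^ ε')
    ∨ (∃ ε ε' : ℤ, (ε = 1 ∨ ε = -1) ∧ (ε' = 1 ∨ ε' = -1) ∧ x = b i ^ ε * b (i + 1) ^ ε')}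

/-- Raising to the power `±1` does not affect membership in a subgroup. -/
theorem Subgroup.zpow_mem_iff_of_eq_one_or_neg_one {G : Type*} [Group G] (H : Subgroup G)
    (x : G) {ε : ℤ} (hε : ε = 1 ∨ ε = -1) : x ^ ε ∈ H ↔ x ∈ H := by
  rcases hε with rfl | rfl <;> simp

/-- If `p` lies in a subgroup `H` and `x` is one of `q^{±1}`, `p^{±1} q^{±1}`, `q^{±1} p^{±1}`,
then `x` lies in `H` if and only if `q` does. -/
theorem Subgroup.mem_iff_of_eq_signed_product {G : Type*} [Group G] (H : Subgroup G)
    {p q x : G} (hp : p ∈ H)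
    (hx : (∃ ε : ℤ, (ε = 1 ∨ ε = -1) ∧ x = q ^ ε)
      ∨ (∃ ε ε' : ℤ, (ε = 1 ∨ ε = -1) ∧ (ε' = 1 ∨ ε' = -1) ∧ x = p ^ ε * q ^ ε')
      ∨ (∃ ε ε' : ℤ, (ε = 1 ∨ ε = -1) ∧ (ε' = 1 ∨ ε' = -1) ∧ x = q ^ ε * p ^ ε')) :
    x ∈ H ↔ q ∈ H := by
  rcases hx with ⟨ε, hε, rfl⟩ | ⟨ε, ε', -, hε', rfl⟩ | ⟨ε, ε', hε, -, rfl⟩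
  · exact H.zpow_mem_iff_of_eq_one_or_neg_one q hε
  · rw [H.mul_mem_cancel_left (H.zpow_mem hp ε), H.zpow_mem_iff_of_eq_one_or_neg_one q hε']
  · rw [H.mul_mem_cancel_right (H.zpow_mem hp ε'), H.zpow_mem_iff_of_eq_one_or_neg_one q hε]

/-- If `a (i - 1)` commutes with `y`, then an allowed choice for `A i` commutes with `y`
if and only if `a i` does. -/
theorem commute_iff_of_mem_choiceA {G : Type*} [Group G] {a : ℕ → G} {i : ℕ} {x y : G}
    (hx : x ∈ ChoiceA a i) (h : Commute (a (i - 1)) y) : Commute x y ↔ Commute (a i) y := by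
  have := (Subgroup.centralizer {y}).mem_iff_of_eq_signed_product
    (Subgroup.mem_centralizer_singleton_iff.2 h) hx
  rwa [Subgroup.mem_centralizer_singleton_iff, Subgroup.mem_centralizer_singleton_iff] at this

/-- If `b (j + 1)` commutes with `x`, then an allowed choice for `B j` commutes with `x`
if and only if `b j` does. -/
theorem commute_iff_of_mem_choiceB {G : Type*} [Group G] {b : ℕ → G} {j : ℕ} {x y : G}
    (hy : y ∈ ChoiceB b j) (h : Commute x (b (j + 1))) : Commute x y ↔ Commute x (b j) := by
  have := (Subgroup.centralizer {x}).mem_iff_of_eq_signed_product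
    (Subgroup.mem_centralizer_singleton_iff.2 h.symm) hy
  rw [Subgroup.mem_centralizer_singleton_iff, Subgroup.mem_centralizer_singleton_iff] at this
  rw [Commute.symm_iff, Commute.symm_iff (a := x)]
  exact this

/-- **Lemma (change of basis for commutation relations).**
Let `G` be a group, `k ≥ 3`, and `a, b : ℕ → G` with `a 1 = 1` and `b k = 1`. Suppose that
for each `2 ≤ i ≤ k-1` the element `A i` lies in
`{a_i^{±1}, a_{i-1}^{±1} a_i^{±1}, a_i^{±1} a_{i-1}^{±1}}` and `B i` lies in
`{b_i^{±1}, b_{i+1}^{±1} b_i^{±1}, b_i^{±1} b_{i+1}^{±1}}`. Then `a i` commutes with `b j`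
for all `2 ≤ i < j ≤ k-1` if and only if `A i` commutes with `B j`
for all `2 ≤ i < j ≤ k-1`. -/
theorem change_of_basis (G : Type*) [Group G] (k : ℕ) (hk : 3 ≤ k)
    (a b A B : ℕ → G) (ha1 : a 1 = 1) (hbk : b k = 1)
    (hA : ∀ i, 2 ≤ i → i ≤ k - 1 → A i ∈ ChoiceA a i)
    (hB : ∀ i, 2 ≤ i → i ≤ k - 1 → B i ∈ ChoiceB b i) :
    (∀ i j, 2 ≤ i → i < j → j ≤ k - 1 → Commute (a i) (b j)) ↔
    (∀ i j, 2 ≤ i → i < j → j ≤ k - 1 → Commute (A i) (B j)) := by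
  constructor
  · intro h
    have hab : ∀ i j, 1 ≤ i → i < j → j ≤ k → Commute (a i) (b j) := by
      intro i j hi hij hj
      rcases hi.eq_or_lt with rfl | hi
      · rw [ha1]
        exact Commute.one_left _
      · rcases hj.eq_or_lt with rfl | hj
        · rw [hbk]
          exact Commute.one_right _
        · exact h i j hi hij (by omega)
    have hAb : ∀ i j, 2 ≤ i → i < j → j ≤ k → Commute (A i) (b j) := fun i j hi hij hj =>
      (commute_iff_of_mem_choiceA (hA i hi (by omega))
        (hab (i - 1) j (by omega) (by omega) hj)).2 (hab i j (by omega) hij hj)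
    intro i j hi hij hj
    exact (commute_iff_of_mem_choiceB (hB j (by omega) hj)
      (hAb i (j + 1) hi (by omega) (by omega))).2 (hAb i j hi hij (by omega))
  · intro h
    have hAb : ∀ i j, 2 ≤ i → i < j → j ≤ k → Commute (A i) (b j) := by
      intro i j hi hij hj
      induction hj using Nat.decreasingInduction with
      | self =>
        rw [hbk]
        exact Commute.one_right _
      | of_succ j hj ih =>
        exact (commute_iff_of_mem_choiceB (hB j (by omega) (by omega)) (ih (by omega))).1
          (h i j hi hij (by omega))
    have hab : ∀ i j, 1 ≤ i → i < j → j ≤ k → Commute (a i) (b j) := by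
      intro i j hi hij hj
      induction i, hi using Nat.le_induction with
      | base =>
        rw [ha1]
        exact Commute.one_left _
      | succ i hi ih =>
        exact (commute_iff_of_mem_choiceA (hA (i + 1) (by omega) (by omega))
          (ih (by omega))).1 (hAb (i + 1) j (by omega) hij hj)
    intro i j hi hij hj
    exact hab i j (by omega) hij (by omega)
end

section
/- The group B(3,3) is isomorphic to the free group on 5 generators. -/
namespace B33

/-- The image in `F_5` of the generator of `B(3,3)` with the given type and indices, the free
basis being `a_{1,2}, a_{2,1}, a_{2,2}, b_{1,1}, b_{2,1}`. -/
def tripleImage : Fin 3 × ℕ × ℕ → FreeGroup (Fin 5)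
  | (0, 1, 2) => .of 0
  | (0, 2, 1) => .of 1
  | (0, 2, 2) => .of 2
  | (1, 1, 1) => .of 3
  | (1, 2, 1) => .of 4
  | (1, 1, 2) => (.of 4)⁻¹ * .of 3 * .of 0 * (.of 3)⁻¹ * .of 1
  | (1, 2, 2) => .of 4 * .of 3 * (.of 1)⁻¹ * .of 2 * (.of 3)⁻¹
  | (2, 1, 1) => .of 4 * .of 3 * (.of 1)⁻¹
  | (2, 1, 2) => .of 3 * .of 0 * (.of 3)⁻¹
  | (2, 2, 2) => .of 4 * .of 2 * (.of 4)⁻¹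
  | _ => 1

/-- The image in `F_5` of each generator of `B(3,3)`. -/
def genImage (x : BGen 3 3) : FreeGroup (Fin 5) :=
  tripleImage x.1

theorem lift_ga {ℓ i : ℕ} (h : 1 ≤ ℓ ∧ ℓ ≤ 2 ∧ 1 ≤ i ∧ i ≤ 2) :
    FreeGroup.lift genImage (ga 3 3 ℓ i) = tripleImage (0, ℓ, i) := by
  rw [ga, dif_pos h]
  exact FreeGroup.lift_apply_of

theorem lift_gb {ℓ i : ℕ} (h : 1 ≤ ℓ ∧ ℓ ≤ 2 ∧ 1 ≤ i ∧ i ≤ 2) :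
    FreeGroup.lift genImage (gb 3 3 ℓ i) = tripleImage (1, ℓ, i) := by
  rw [gb, dif_pos h]
  exact FreeGroup.lift_apply_of

theorem lift_gc {ℓ i : ℕ} (h : 1 ≤ ℓ ∧ ℓ ≤ 2 ∧ 1 ≤ i ∧ i ≤ 2) :
    FreeGroup.lift genImage (gc 3 3 ℓ i) = tripleImage (2, ℓ, i) := by
  rw [gc, dif_pos h]
  exact FreeGroup.lift_apply_of

theorem lift_genImage_eq_one {r : FreeGroup (BGen 3 3)} (hr : r ∈ Brels 3 3) :
    FreeGroup.lift genImage r = 1 := by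
  rcases hr with rfl | rfl | ⟨ℓ, i, j, hℓ, hℓ', hi, hij, hj, rfl⟩ |
    ⟨ℓ, i, j, hℓ, hℓ', hi, hi', hj, hj', rfl⟩ | ⟨ℓ, i, j, _, _, _, _, _, _, _, rfl⟩ |
    ⟨ℓ, lam, i, j, _, _, _, _, _, _, _, rfl⟩
  · simp [lift_ga, tripleImage]
  · simp [lift_gc, tripleImage]
  · obtain ⟨rfl, rfl⟩ : i = 1 ∧ j = 2 := by omega
    obtain rfl | rfl : ℓ = 1 ∨ ℓ = 2 := by omega
    all_goals simp [lift_ga, lift_gb, lift_gc, tripleImage]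
  · obtain rfl : ℓ = 1 := by omega
    obtain ⟨rfl, rfl⟩ | ⟨rfl, rfl⟩ | ⟨rfl, rfl⟩ :
        (i = 1 ∧ j = 1) ∨ (i = 1 ∧ j = 2) ∨ (i = 2 ∧ j = 1) := by omega
    all_goals simp [lift_ga, lift_gb, lift_gc, tripleImage, mul_assoc]
  · omega
  · omega

/-- The homomorphism `B(3,3) → F_5` induced by `genImage`. -/
def toFree : B 3 3 →* FreeGroup (Fin 5) :=
  PresentedGroup.toGroup fun _ hr => lift_genImage_eq_one hr

/-- The homomorphism `F_5 → B(3,3)` onto the chosen free basis. -/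
def ofFree : FreeGroup (Fin 5) →* B 3 3 :=
  FreeGroup.lift fun k => PresentedGroup.mk (Brels 3 3)
    (![ga 3 3 1 2, ga 3 3 2 1, ga 3 3 2 2, gb 3 3 1 1, gb 3 3 2 1] k)

theorem toFree_mk (w : FreeGroup (BGen 3 3)) :
    toFree (PresentedGroup.mk (Brels 3 3) w) = FreeGroup.lift genImage w :=
  rfl

theorem toFree_comp_ofFree : toFree.comp ofFree = MonoidHom.id _ := by
  ext k
  fin_cases k <;> simp [ofFree, toFree_mk, lift_ga, lift_gb, tripleImage]

theorem mk_conj (ℓ : ℕ) (hℓ : 1 ≤ ℓ) (hℓ' : ℓ ≤ 2) :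
    PresentedGroup.mk (Brels 3 3) (gc 3 3 ℓ 2) =
      .mk _ (gb 3 3 ℓ 1) * .mk _ (ga 3 3 ℓ 2) * (.mk _ (gb 3 3 ℓ 1))⁻¹ := by
  have h := PresentedGroup.one_of_mem (rels := Brels 3 3) <|
    .inr <| .inr <| .inl ⟨ℓ, 1, 2, hℓ, hℓ', le_rfl, by norm_num, le_rfl, rfl⟩
  simp only [map_mul, map_inv] at h
  exact (mul_inv_eq_one.mp h).symm

theorem mk_square (i j : ℕ) (hi : 1 ≤ i) (hj : 1 ≤ j) (hij : i + j ≤ 3) :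
    PresentedGroup.mk (Brels 3 3) (gc 3 3 1 i) * .mk _ (ga 3 3 2 j) =
      .mk _ (gb 3 3 2 j) * .mk _ (gb 3 3 1 i) := by
  have h := PresentedGroup.one_of_mem (rels := Brels 3 3) <|
    .inr <| .inr <| .inr <| .inl
      ⟨1, i, j, le_rfl, le_rfl, hi, by omega, hj, by omega, rfl⟩
  simp only [map_mul, map_inv] at h
  exact mul_inv_eq_iff_eq_mul.mp (mul_inv_eq_one.mp h)

theorem ofFree_comp_toFree : ofFree.comp toFree = MonoidHom.id _ := by
  have ha : PresentedGroup.mk (Brels 3 3) (ga 3 3 1 1) = 1 :=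
    PresentedGroup.one_of_mem (.inl rfl)
  have hc : PresentedGroup.mk (Brels 3 3) (gc 3 3 2 1) = 1 :=
    PresentedGroup.one_of_mem (.inr (.inl rfl))
  have hc₁ := mk_conj 1 le_rfl one_le_two
  have hc₂ := mk_conj 2 one_le_two le_rfl
  have h₁₁ := eq_mul_inv_of_mul_eq (mk_square 1 1 le_rfl le_rfl (by norm_num))
  have h₁₂ := eq_mul_inv_of_mul_eq (mk_square 1 2 le_rfl one_le_two le_rfl).symm
  have h₂₁ := eq_inv_mul_of_mul_eq (mk_square 2 1 one_le_two le_rfl le_rfl).symm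
  rw [h₁₁] at h₁₂
  rw [hc₁] at h₂₁
  have key (t : Fin 3) (ℓ i : ℕ) (h : 1 ≤ ℓ ∧ ℓ ≤ 2 ∧ 1 ≤ i ∧ i ≤ 2) :
      ofFree (tripleImage (t, ℓ, i)) =
        PresentedGroup.mk (Brels 3 3) (![ga 3 3 ℓ i, gb 3 3 ℓ i, gc 3 3 ℓ i] t) := by
    obtain ⟨hℓ, hℓ', hi, hi'⟩ := h
    interval_cases ℓ <;> interval_cases i <;> fin_cases t <;>
      simp [ofFree, tripleImage, ha, hc, hc₁, hc₂, h₁₁, h₁₂, h₂₁, mul_assoc]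
  ext x
  rw [MonoidHom.comp_apply, toFree, PresentedGroup.toGroup.of, MonoidHom.id_apply]
  obtain ⟨⟨t, ℓ, i⟩, h⟩ := x
  refine (key t ℓ i h).trans (congrArg (PresentedGroup.mk (Brels 3 3)) ?_)
  fin_cases t
  exacts [dif_pos h, dif_pos h, dif_pos h]

end B33

/-- **Example.** `B(3,3) ≅ F_5`, the free group on 5 generators. -/
theorem B33_iso_free_group_rank_five : Nonempty (B 3 3 ≃* FreeGroup (Fin 5)) :=
  ⟨B33.toFree.toMulEquiv B33.ofFree B33.ofFree_comp_toFree B33.toFree_comp_ofFree⟩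
end

section
/- The group B(5,3) is isomorphic to RAAG(Γ), where Γ is the simple graph with nine vertices x_1, x_2, x'_1, x'_2, y_1, y_2, y'_1, y'_2, z whose edges are exactly: {x_i, x'_j}, {x'_i, y'_j}, {y'_i, y_j}, {y_i, x_j} for each pair (i,j) ∈ {(1,2), (2,1), (2,2)}, with z an isolated vertex (this is the graph S_2 plus one isolated vertex). -/
/-- The RAAG relators of a simple graph: one commutator for each edge. -/
def RAAGrels {V : Type*} (Γ : SimpleGraph V) : Set (FreeGroup V) :=
  {r | ∃ u v : V, Γ.Adj u v ∧ r = gcomm (FreeGroup.of u) (FreeGroup.of v)}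

/-- The right-angled Artin group of a simple graph. -/
abbrev RAAG {V : Type*} (Γ : SimpleGraph V) : Type _ := PresentedGroup (RAAGrels Γ)

/-- Vertices of the graph `S_2 + 1`: `Sum.inl (k, i)` with `k ∈ Fin 4`
(`k = 0` for `x`, `k = 1` for `x'`, `k = 2` for `y'`, `k = 3` for `y`) and `i ∈ Fin 2`
(for subscripts `1, 2`), together with one isolated vertex `Sum.inr ()` (the vertex `z`). -/
def S2Vertex : Type := (Fin 4 × Fin 2) ⊕ Unit

/-- The graph `S_2` plus one isolated vertex: the edges are `{x_i, x'_j}`, `{x'_i, y'_j}`,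
`{y'_i, y_j}`, `{y_i, x_j}` for `(i, j) ∈ {(1,2), (2,1), (2,2)}` (i.e. zero-based pairs
with `i + j ≥ 1`), obtained as edges between consecutive (cyclic) families `k` and `k + 1`. -/
def S2PlusOne : SimpleGraph S2Vertex :=
  SimpleGraph.fromRel (fun a b =>
    ∃ (k : Fin 4) (i j : Fin 2), 1 ≤ i.val + j.val ∧
      a = Sum.inl (k, i) ∧ b = Sum.inl (k + 1, j))

namespace SquareBraid

variable {G H : Type*} [Group G] [Group H]

/-- The defining relations of `B(5,3)`, for a triple of families `a`, `b`, `c` in a group. -/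
structure Relations (a b c : ℕ → ℕ → G) : Prop where
  a_one : a 1 1 = 1
  c_one : c 2 1 = 1
  conj : ∀ ℓ i j, 1 ≤ ℓ → ℓ ≤ 2 → 1 ≤ i → i < j → j ≤ 4 → b ℓ i * a ℓ j * (b ℓ i)⁻¹ = c ℓ j
  swap : ∀ i j, 1 ≤ i → 1 ≤ j → i + j ≤ 5 → c 1 i * a 2 j = b 2 j * b 1 i
  comm : ∀ i j, i ≤ 4 → j ≤ 4 → 7 ≤ i + j → Commute (c 1 i) (a 2 j)

/-- The commutations prescribed by the edges of `S2PlusOne` among elements `v k i`. -/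
def EdgesCommute (v : Fin 4 → Fin 2 → G) : Prop :=
  ∀ (k : Fin 4) (i j : Fin 2), 1 ≤ i.val + j.val → Commute (v k i) (v (k + 1) j)

/-- The image of `c_{1,i}` in terms of the vertices of `S2PlusOne`. -/
def lowerC (v : Fin 4 → Fin 2 → G) (z : G) : ℕ → G
  | 1 => z⁻¹ * v 3 0 * z * (v 0 0)⁻¹
  | 2 => z⁻¹ * v 3 0 * z * (v 0 0)⁻¹ * v 0 1
  | 3 => z⁻¹ * v 3 0 * z
  | _ => z⁻¹ * v 3 1 * z

/-- The image of `a_{2,i}` in terms of the vertices of `S2PlusOne`. -/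
def upperA (v : Fin 4 → Fin 2 → G) (z : G) : ℕ → G
  | 1 => (v 1 0)⁻¹ * (z⁻¹ * v 2 0 * z)
  | 2 => v 1 1 * (v 1 0)⁻¹ * (z⁻¹ * v 2 0 * z)
  | 3 => z⁻¹ * v 2 0 * z
  | _ => z⁻¹ * v 2 1 * z

/-- The family `b` determined by `c_{1,i}`, `a_{2,i}` and `z`. -/
def wordB (c a : ℕ → G) (z : G) (ℓ i : ℕ) : G :=
  if ℓ = 1 then z⁻¹ * ((c 1)⁻¹ * c i) * a 1 else c 1 * (a i * (a 1)⁻¹) * z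

/-- The family `a` determined by `c_{1,i}`, `a_{2,i}` and `z`. -/
def wordA (c a : ℕ → G) (z : G) (ℓ i : ℕ) : G :=
  if ℓ = 1 then if i = 1 then 1 else (z⁻¹ * a 1)⁻¹ * c i * (z⁻¹ * a 1) else a i

/-- The family `c` determined by `c_{1,i}`, `a_{2,i}` and `z`. -/
def wordC (c a : ℕ → G) (z : G) (ℓ i : ℕ) : G :=
  if ℓ = 1 then c i else if i = 1 then 1 else (c 1 * z) * a i * (c 1 * z)⁻¹

/-- The images of the non-isolated vertices of `S2PlusOne` in terms of the families
`c = c_{1,·}` and `a = a_{2,·}` and the image `z` of the isolated vertex. -/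
def vertexWord (c a : ℕ → G) (z : G) (k : Fin 4) (i : Fin 2) : G :=
  ![![(c 1)⁻¹ * c 3, (c 1)⁻¹ * c 2],
    ![a 3 * (a 1)⁻¹, a 2 * (a 1)⁻¹],
    ![z * a 3 * z⁻¹, z * a 4 * z⁻¹],
    ![z * c 3 * z⁻¹, z * c 4 * z⁻¹]] k i

lemma commute_of_conj_eq {x y a c : G} (hx : x * a * x⁻¹ = c) (hy : y * a * y⁻¹ = c) :
    Commute (x⁻¹ * y) a := by
  have hc : c * x = x * a := by rw [← hx]; group
  calc x⁻¹ * y * a = x⁻¹ * (c * y) := by rw [← hy]; group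
    _ = x⁻¹ * (c * x) * (x⁻¹ * y) := by group
    _ = a * (x⁻¹ * y) := by rw [hc]; group

lemma commute_conj {u c : G} (z : G) (h : Commute u c) :
    Commute (z * u * z⁻¹) (z * c * z⁻¹) :=
  (SemiconjBy.conj_iff (a := u) (x := c) (y := c) (b := z)).mpr h

lemma conj_eq_self_of_commute {u c : G} (h : Commute u c) : u * c * u⁻¹ = c := by
  rw [h.eq]; group

lemma commute_of_swap {c₁ c₂ a₁ a₂ b₁ b₂ d₁ d₂ : G} (h₁₁ : c₁ * a₁ = d₁ * b₁)
    (h₁₂ : c₁ * a₂ = d₂ * b₁) (h₂₁ : c₂ * a₁ = d₁ * b₂) (h₂₂ : c₂ * a₂ = d₂ * b₂) :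
    Commute (c₁⁻¹ * c₂) (a₂ * a₁⁻¹) := by
  have e₁ : c₁ = d₁ * b₁ * a₁⁻¹ := eq_mul_inv_of_mul_eq h₁₁
  have e₂ : c₂ = d₁ * b₂ * a₁⁻¹ := eq_mul_inv_of_mul_eq h₂₁
  have ed : d₂ = c₁ * a₂ * b₁⁻¹ := eq_mul_inv_of_mul_eq h₁₂.symm
  calc c₁⁻¹ * c₂ * (a₂ * a₁⁻¹) = c₁⁻¹ * (c₂ * a₂) * a₁⁻¹ := by group
    _ = a₂ * a₁⁻¹ * (c₁⁻¹ * c₂) := by rw [h₂₂, ed, e₂, e₁]; group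

lemma Relations.edgesCommute {a b c : ℕ → ℕ → G} (h : Relations a b c) :
    EdgesCommute (vertexWord (c 1) (a 2) (a 2 1 * (b 1 1)⁻¹)) := by
  have hz : (c 1 1)⁻¹ * b 2 1 = a 2 1 * (b 1 1)⁻¹ := by
    rw [inv_mul_eq_iff_eq_mul, ← mul_assoc, eq_mul_inv_iff_mul_eq, h.swap 1 1] <;> norm_num
  have huw : ∀ i j, 1 ≤ i → 1 ≤ j → i + j ≤ 5 →
      Commute ((c 1 1)⁻¹ * c 1 i) (a 2 j * (a 2 1)⁻¹) := fun i j hi hj hij =>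
    commute_of_swap (h.swap 1 1 le_rfl le_rfl (by omega)) (h.swap 1 j le_rfl hj (by omega))
      (h.swap i 1 hi le_rfl (by omega)) (h.swap i j hi hj hij)
  have hwQ : ∀ i j, 1 ≤ i → i < j → j ≤ 4 → Commute (a 2 i * (a 2 1)⁻¹)
      (a 2 1 * (b 1 1)⁻¹ * a 2 j * (a 2 1 * (b 1 1)⁻¹)⁻¹) := fun i j hi hij hj => by
    have key := commute_conj (a 2 1 * (b 1 1)⁻¹) (commute_of_conj_eq
      (h.conj 2 1 j (by omega) le_rfl le_rfl (by omega) hj)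
      (h.conj 2 i j (by omega) le_rfl hi hij hj))
    have e : a 2 1 * (b 1 1)⁻¹ * ((b 2 1)⁻¹ * b 2 i) * (a 2 1 * (b 1 1)⁻¹)⁻¹ =
        a 2 i * (a 2 1)⁻¹ := by
      rw [eq_mul_inv_of_mul_eq (h.swap 1 i le_rfl hi (by omega)).symm, ← hz]
      rw [eq_mul_inv_of_mul_eq (h.swap 1 1 le_rfl le_rfl (by omega)).symm]
      group
    rwa [e] at key
  have huP : ∀ i j, 1 ≤ i → i < j → j ≤ 4 → Commute ((c 1 1)⁻¹ * c 1 i)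
      (a 2 1 * (b 1 1)⁻¹ * c 1 j * (a 2 1 * (b 1 1)⁻¹)⁻¹) := fun i j hi hij hj => by
    have key := commute_conj (a 2 1) (commute_of_conj_eq
      (h.conj 1 1 j le_rfl (by omega) le_rfl (by omega) hj)
      (h.conj 1 i j le_rfl (by omega) hi hij hj))
    have e : a 2 1 * ((b 1 1)⁻¹ * b 1 i) * (a 2 1)⁻¹ = (c 1 1)⁻¹ * c 1 i := by
      rw [eq_mul_inv_of_mul_eq (h.swap 1 1 le_rfl le_rfl (by omega)),
        eq_mul_inv_of_mul_eq (h.swap i 1 hi le_rfl (by omega))]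
      group
    have e' : a 2 1 * a 1 j * (a 2 1)⁻¹ =
        a 2 1 * (b 1 1)⁻¹ * c 1 j * (a 2 1 * (b 1 1)⁻¹)⁻¹ := by
      rw [← h.conj 1 1 j le_rfl (by omega) le_rfl (by omega) hj]
      group
    rwa [e, e'] at key
  have hQP : ∀ i j, i ≤ 4 → j ≤ 4 → 7 ≤ i + j →
      Commute (a 2 1 * (b 1 1)⁻¹ * a 2 j * (a 2 1 * (b 1 1)⁻¹)⁻¹)
        (a 2 1 * (b 1 1)⁻¹ * c 1 i * (a 2 1 * (b 1 1)⁻¹)⁻¹) := fun i j hi hj hij =>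
    commute_conj _ (h.comm i j hi hj hij).symm
  intro k i j hij
  fin_cases k <;> fin_cases i <;> fin_cases j <;>
    first
    | exact absurd hij (by decide)
    | exact huw _ _ (by norm_num) (by norm_num) (by norm_num)
    | exact hwQ _ _ (by norm_num) (by norm_num) (by norm_num)
    | exact hQP _ _ (by norm_num) (by norm_num) (by norm_num)
    | exact (huP _ _ (by norm_num) (by norm_num) (by norm_num)).symm

/-- Families in `c = c_{1,·}` and `a = a_{2,·}` whose vertex words commute satisfy the relations
of `B(5,3)`. -/
lemma relations_of_edgesCommute {c a : ℕ → G} {z : G} (h : EdgesCommute (vertexWord c a z)) :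
    Relations (wordA c a z) (wordB c a z) (wordC c a z) := by
  refine ⟨by simp [wordA], by simp [wordC], ?_, ?_, ?_⟩
  · intro ℓ i j hℓ hℓ' hi hij hj
    have hj1 : j ≠ 1 := by omega
    obtain rfl | rfl : ℓ = 1 ∨ ℓ = 2 := by omega
    · have key : Commute ((c 1)⁻¹ * c i) (z * c j * z⁻¹) := by
        have hi3 : i ≤ 3 := by omega
        interval_cases i
        · simp
        all_goals interval_cases j
        exacts [(h 3 0 1 (by decide)).symm, (h 3 1 1 (by decide)).symm,
          (h 3 1 0 (by decide)).symm]
      have e := conj_eq_self_of_commute key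
      simp only [wordA, wordB, wordC, hj1, if_true, if_false]
      calc _ = z⁻¹ * ((c 1)⁻¹ * c i * (z * c j * z⁻¹) * ((c 1)⁻¹ * c i)⁻¹) * z := by group
        _ = c j := by rw [e]; group
    · have key : Commute (a i * (a 1)⁻¹) (z * a j * z⁻¹) := by
        have hi3 : i ≤ 3 := by omega
        interval_cases i
        · simp
        all_goals interval_cases j
        exacts [h 1 1 0 (by decide), h 1 1 1 (by decide), h 1 0 1 (by decide)]
      have e := conj_eq_self_of_commute key
      simp only [wordA, wordB, wordC, hj1, if_false, OfNat.ofNat_ne_one]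
      calc _ = c 1 * (a i * (a 1)⁻¹ * (z * a j * z⁻¹) * (a i * (a 1)⁻¹)⁻¹) * (c 1)⁻¹ := by group
        _ = _ := by rw [e]; group
  · intro i j hi hj hij
    have key : Commute ((c 1)⁻¹ * c i) (a j * (a 1)⁻¹) := by
      obtain rfl | hi1 := eq_or_ne i 1
      · simp
      obtain rfl | hj1 := eq_or_ne j 1
      · simp
      obtain ⟨rfl, rfl⟩ | ⟨rfl, rfl⟩ | ⟨rfl, rfl⟩ :
          i = 2 ∧ j = 2 ∨ i = 2 ∧ j = 3 ∨ i = 3 ∧ j = 2 := by omega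
      exacts [h 0 1 1 (by decide), h 0 1 0 (by decide), h 0 0 1 (by decide)]
    simp only [wordA, wordB, wordC, if_true, if_false, OfNat.ofNat_ne_one]
    calc c i * a j = c 1 * ((c 1)⁻¹ * c i * (a j * (a 1)⁻¹)) * a 1 := by group
      _ = _ := by rw [key.eq]; group
  · intro i j hi hj hij
    have key : Commute (z * a j * z⁻¹) (z * c i * z⁻¹) := by
      obtain ⟨rfl, rfl⟩ | ⟨rfl, rfl⟩ | ⟨rfl, rfl⟩ :
          i = 3 ∧ j = 4 ∨ i = 4 ∧ j = 3 ∨ i = 4 ∧ j = 4 := by omega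
      exacts [h 2 1 0 (by decide), h 2 0 1 (by decide), h 2 1 1 (by decide)]
    have e : Commute (a j) (c i) := SemiconjBy.conj_iff.mp key
    simpa [wordA, wordC] using e.symm

lemma Relations.word_eq {a b c : ℕ → ℕ → G} (h : Relations a b c) {ℓ i : ℕ}
    (hℓ : 1 ≤ ℓ) (hℓ' : ℓ ≤ 2) (hi : 1 ≤ i) (hi' : i ≤ 4) :
    wordA (c 1) (a 2) (a 2 1 * (b 1 1)⁻¹) ℓ i = a ℓ i ∧
    wordB (c 1) (a 2) (a 2 1 * (b 1 1)⁻¹) ℓ i = b ℓ i ∧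
    wordC (c 1) (a 2) (a 2 1 * (b 1 1)⁻¹) ℓ i = c ℓ i := by
  have hc := fun i hi hi' => eq_mul_inv_of_mul_eq (h.swap i 1 hi le_rfl hi')
  have hb := fun i hi hi' => eq_mul_inv_of_mul_eq (h.swap 1 i le_rfl hi hi').symm
  obtain rfl | rfl : ℓ = 1 ∨ ℓ = 2 := by omega
  · refine ⟨?_, ?_, by simp [wordC]⟩
    · obtain rfl | hi1 := eq_or_ne i 1
      · simp [wordA, h.a_one]
      · simp only [wordA, hi1, if_true, if_false]
        rw [← h.conj 1 1 i le_rfl (by omega) le_rfl (by omega) hi']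
        group
    · simp only [wordB, if_true]
      rw [hc i hi (by omega), hc 1 le_rfl (by omega)]
      group
  · refine ⟨by simp [wordA], ?_, ?_⟩
    · simp only [wordB, if_false, OfNat.ofNat_ne_one]
      rw [hb i hi (by omega)]
      group
    · obtain rfl | hi1 := eq_or_ne i 1
      · simp [wordC, h.c_one]
      · simp only [wordC, hi1, if_false, OfNat.ofNat_ne_one]
        rw [← h.conj 2 1 i (by omega) le_rfl le_rfl (by omega) hi', hb 1 le_rfl (by omega)]
        group

lemma lowerC_vertexWord (c a : ℕ → G) (z : G) {i : ℕ} (hi : 1 ≤ i) (hi' : i ≤ 4) :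
    lowerC (vertexWord c a z) z i = c i := by
  interval_cases i <;> simp [lowerC, vertexWord, mul_assoc]

lemma upperA_vertexWord (c a : ℕ → G) (z : G) {i : ℕ} (hi : 1 ≤ i) (hi' : i ≤ 4) :
    upperA (vertexWord c a z) z i = a i := by
  interval_cases i <;> simp [upperA, vertexWord, mul_assoc]

lemma vertexWord_lowerC_upperA (v : Fin 4 → Fin 2 → G) (z : G) (k : Fin 4) (i : Fin 2) :
    vertexWord (lowerC v z) (upperA v z) z k i = v k i := by
  fin_cases k <;> fin_cases i <;> simp [lowerC, upperA, vertexWord, mul_assoc]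

lemma map_wordA (f : G →* H) (c a : ℕ → G) (z : G) (ℓ i : ℕ) :
    f (wordA c a z ℓ i) = wordA (f ∘ c) (f ∘ a) (f z) ℓ i := by
  simp [wordA, apply_ite f]

lemma map_wordB (f : G →* H) (c a : ℕ → G) (z : G) (ℓ i : ℕ) :
    f (wordB c a z ℓ i) = wordB (f ∘ c) (f ∘ a) (f z) ℓ i := by
  simp [wordB, apply_ite f]

lemma map_wordC (f : G →* H) (c a : ℕ → G) (z : G) (ℓ i : ℕ) :
    f (wordC c a z ℓ i) = wordC (f ∘ c) (f ∘ a) (f z) ℓ i := by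
  simp [wordC, apply_ite f]

lemma map_lowerC (f : G →* H) (v : Fin 4 → Fin 2 → G) (z : G) (i : ℕ) :
    f (lowerC v z i) = lowerC (fun k j => f (v k j)) (f z) i := by
  unfold lowerC; split <;> simp

lemma map_upperA (f : G →* H) (v : Fin 4 → Fin 2 → G) (z : G) (i : ℕ) :
    f (upperA v z i) = upperA (fun k j => f (v k j)) (f z) i := by
  unfold upperA; split <;> simp

lemma map_vertexWord (f : G →* H) (c a : ℕ → G) (z : G) (k : Fin 4) (i : Fin 2) :
    f (vertexWord c a z k i) = vertexWord (f ∘ c) (f ∘ a) (f z) k i := by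
  fin_cases k <;> fin_cases i <;> simp [vertexWord]

lemma vertexWord_congr {c c' a a' : ℕ → G} (z : G) (hc : ∀ i, 1 ≤ i → i ≤ 4 → c i = c' i)
    (ha : ∀ i, 1 ≤ i → i ≤ 4 → a i = a' i) : vertexWord c a z = vertexWord c' a' z := by
  simp [funext_iff, vertexWord, hc, ha]

/-- The assignment on generators of `B(5,3)` given by three families. -/
def genAssign (a b c : ℕ → ℕ → G) (x : BGen 5 3) : G :=
  ![a, b, c] x.1.1 x.1.2.1 x.1.2.2

section Lift

variable (a b c : ℕ → ℕ → G) {ℓ i : ℕ}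

lemma lift_ga (hℓ : 1 ≤ ℓ) (hℓ' : ℓ ≤ 2) (hi : 1 ≤ i) (hi' : i ≤ 4) :
    FreeGroup.lift (genAssign a b c) (ga 5 3 ℓ i) = a ℓ i := by
  rw [ga, dif_pos ⟨hℓ, hℓ', hi, hi'⟩]; exact FreeGroup.lift_apply_of

lemma lift_gb (hℓ : 1 ≤ ℓ) (hℓ' : ℓ ≤ 2) (hi : 1 ≤ i) (hi' : i ≤ 4) :
    FreeGroup.lift (genAssign a b c) (gb 5 3 ℓ i) = b ℓ i := by
  rw [gb, dif_pos ⟨hℓ, hℓ', hi, hi'⟩]; exact FreeGroup.lift_apply_of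

lemma lift_gc (hℓ : 1 ≤ ℓ) (hℓ' : ℓ ≤ 2) (hi : 1 ≤ i) (hi' : i ≤ 4) :
    FreeGroup.lift (genAssign a b c) (gc 5 3 ℓ i) = c ℓ i := by
  rw [gc, dif_pos ⟨hℓ, hℓ', hi, hi'⟩]; exact FreeGroup.lift_apply_of

end Lift

lemma Relations.lift_eq_one {a b c : ℕ → ℕ → G} (h : Relations a b c) :
    ∀ r ∈ Brels 5 3, FreeGroup.lift (genAssign a b c) r = 1 := by
  rintro r (rfl | rfl | ⟨ℓ, i, j, hℓ, hℓ', hi, hij, hj, rfl⟩ |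
    ⟨ℓ, i, j, hℓ, hℓ', hi, hi', hj, hij, rfl⟩ |
    ⟨ℓ, i, j, hℓ, hℓ', hi, hi', hj, hj', hij, rfl⟩ | ⟨ℓ, m, i, j, hℓ, hm, hm', -⟩)
  · rw [lift_ga _ _ _ le_rfl (by omega) le_rfl (by omega), h.a_one]
  · rw [lift_gc _ _ _ (by omega) (by omega) le_rfl (by omega), h.c_one]
  · simp only [map_mul, map_inv]
    rw [lift_ga, lift_gb, lift_gc, h.conj ℓ i j, mul_inv_cancel] <;> omega
  · obtain rfl : ℓ = 1 := by omega
    simp only [map_mul, map_inv]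
    rw [lift_ga, lift_gb, lift_gb, lift_gc, h.swap i j] <;> first | omega | skip
    group
  · obtain rfl : ℓ = 1 := by omega
    simp only [gcomm, map_mul, map_inv]
    rw [lift_ga, lift_gc, (h.comm i j (by omega) (by omega) (by omega)).eq] <;>
      first | omega | skip
    group
  · omega

/-- The class of `a_{ℓ,i}` in `B(5,3)`. -/
def clsA (ℓ i : ℕ) : B 5 3 := PresentedGroup.mk _ (ga 5 3 ℓ i)

/-- The class of `b_{ℓ,i}` in `B(5,3)`. -/
def clsB (ℓ i : ℕ) : B 5 3 := PresentedGroup.mk _ (gb 5 3 ℓ i)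

/-- The class of `c_{ℓ,i}` in `B(5,3)`. -/
def clsC (ℓ i : ℕ) : B 5 3 := PresentedGroup.mk _ (gc 5 3 ℓ i)

lemma relations_cls : Relations clsA clsB clsC where
  a_one := PresentedGroup.one_of_mem (.inl rfl)
  c_one := PresentedGroup.one_of_mem (.inr (.inl rfl))
  conj ℓ i j hℓ hℓ' hi hij hj := by
    rw [← mul_inv_eq_one]
    exact PresentedGroup.one_of_mem (.inr (.inr (.inl ⟨ℓ, i, j, hℓ, hℓ', hi, hij, hj, rfl⟩)))
  swap i j hi hj hij := by
    rw [← mul_inv_eq_one, mul_inv_rev, ← mul_assoc]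
    exact PresentedGroup.one_of_mem (.inr (.inr (.inr (.inl
      ⟨1, i, j, by omega, by omega, hi, by omega, hj, by omega, rfl⟩))))
  comm i j hi hj hij := by
    rw [← commutatorElement_eq_one_iff_commute]
    exact PresentedGroup.one_of_mem (.inr (.inr (.inr (.inr (.inl
      ⟨1, i, j, by omega, by omega, by omega, by omega, by omega, by omega, by omega, rfl⟩)))))

/-- The assignment on vertices of `S2PlusOne` given by elements `v k i` and `z`. -/
def vertexAssign (v : Fin 4 → Fin 2 → G) (z : G) (x : S2Vertex) : G :=
  Sum.elim (fun p : Fin 4 × Fin 2 => v p.1 p.2) (fun _ : Unit => z) x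

lemma EdgesCommute.lift_eq_one {v : Fin 4 → Fin 2 → G} (h : EdgesCommute v) (z : G) :
    ∀ r ∈ RAAGrels S2PlusOne, FreeGroup.lift (vertexAssign v z) r = 1 := by
  rintro r ⟨x, y, hxy, rfl⟩
  simp only [gcomm, map_mul, map_inv, FreeGroup.lift_apply_of]
  obtain ⟨-, ⟨k, i, j, hij, rfl, rfl⟩ | ⟨k, i, j, hij, rfl, rfl⟩⟩ := hxy
  · exact commutatorElement_eq_one_iff_commute.mpr (h k i j hij)
  · exact commutatorElement_eq_one_iff_commute.mpr (h k i j hij).symm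

/-- The class of a non-isolated vertex in `RAAG S2PlusOne`. -/
def clsV (k : Fin 4) (i : Fin 2) : RAAG S2PlusOne :=
  PresentedGroup.of (Sum.inl (k, i) : S2Vertex)

/-- The class of the isolated vertex in `RAAG S2PlusOne`. -/
def clsZ : RAAG S2PlusOne := PresentedGroup.of (Sum.inr () : S2Vertex)

lemma edgesCommute_clsV : EdgesCommute clsV := by
  intro k i j hij
  rw [← commutatorElement_eq_one_iff_commute]
  refine PresentedGroup.one_of_mem ⟨_, _, ⟨fun e => ?_, .inl ⟨k, i, j, hij, rfl, rfl⟩⟩, rfl⟩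
  have hk : k = k + 1 := congrArg Prod.fst (Sum.inl_injective e)
  revert hk
  fin_cases k <;> decide

/-- The relations of `B(5,3)` hold for the words in the vertices of `S2PlusOne`. -/
lemma relations_word_cls :
    Relations (wordA (lowerC clsV clsZ) (upperA clsV clsZ) clsZ)
      (wordB (lowerC clsV clsZ) (upperA clsV clsZ) clsZ)
      (wordC (lowerC clsV clsZ) (upperA clsV clsZ) clsZ) := by
  apply relations_of_edgesCommute
  intro k i j hij
  simpa only [vertexWord_lowerC_upperA] using edgesCommute_clsV k i j hij

/-- The homomorphism from `B(5,3)` to the right-angled Artin group. -/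
def toRAAG : B 5 3 →* RAAG S2PlusOne := PresentedGroup.toGroup relations_word_cls.lift_eq_one

/-- The homomorphism from the right-angled Artin group to `B(5,3)`. -/
def ofRAAG : RAAG S2PlusOne →* B 5 3 :=
  PresentedGroup.toGroup (relations_cls.edgesCommute.lift_eq_one (clsA 2 1 * (clsB 1 1)⁻¹))

lemma ofRAAG_clsV (k : Fin 4) (i : Fin 2) :
    ofRAAG (clsV k i) = vertexWord (clsC 1) (clsA 2) (clsA 2 1 * (clsB 1 1)⁻¹) k i :=
  PresentedGroup.toGroup.of _

lemma ofRAAG_clsZ : ofRAAG clsZ = clsA 2 1 * (clsB 1 1)⁻¹ :=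
  PresentedGroup.toGroup.of _

lemma ofRAAG_lowerC {i : ℕ} (hi : 1 ≤ i) (hi' : i ≤ 4) :
    ofRAAG (lowerC clsV clsZ i) = clsC 1 i := by
  simp_rw [map_lowerC, ofRAAG_clsV, ofRAAG_clsZ]
  exact lowerC_vertexWord _ _ _ hi hi'

lemma ofRAAG_upperA {i : ℕ} (hi : 1 ≤ i) (hi' : i ≤ 4) :
    ofRAAG (upperA clsV clsZ i) = clsA 2 i := by
  simp_rw [map_upperA, ofRAAG_clsV, ofRAAG_clsZ]
  exact upperA_vertexWord _ _ _ hi hi'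

lemma ofRAAG_comp_toRAAG : ofRAAG.comp toRAAG = MonoidHom.id _ := by
  refine PresentedGroup.ext ?_
  rintro ⟨⟨t, ℓ, i⟩, hx⟩
  obtain ⟨hℓ, hℓ', hi, hi'⟩ := id hx
  obtain ⟨eA, eB, eC⟩ := relations_cls.word_eq hℓ hℓ' hi hi'
  have h1 := ofRAAG_lowerC le_rfl (show 1 ≤ 4 by omega)
  have h2 := ofRAAG_upperA le_rfl (show 1 ≤ 4 by omega)
  have h3 := ofRAAG_lowerC hi hi'
  have h4 := ofRAAG_upperA hi hi'
  refine (congrArg ofRAAG (PresentedGroup.toGroup.of relations_word_cls.lift_eq_one)).trans ?_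
  fin_cases t
  · refine ((map_wordA _ _ _ _ _ _).trans ?_).trans (eA.trans ?_)
    · simp only [wordA, Function.comp_apply, h2, h3, h4, ofRAAG_clsZ]
    · rw [clsA, ga, dif_pos hx]; rfl
  · refine ((map_wordB _ _ _ _ _ _).trans ?_).trans (eB.trans ?_)
    · simp only [wordB, Function.comp_apply, h1, h2, h3, h4, ofRAAG_clsZ]
    · rw [clsB, gb, dif_pos hx]; rfl
  · refine ((map_wordC _ _ _ _ _ _).trans ?_).trans (eC.trans ?_)
    · simp only [wordC, Function.comp_apply, h1, h3, h4, ofRAAG_clsZ]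
    · rw [clsC, gc, dif_pos hx]; rfl

lemma toRAAG_clsC {i : ℕ} (hi : 1 ≤ i) (hi' : i ≤ 4) :
    toRAAG (clsC 1 i) = lowerC clsV clsZ i :=
  (lift_gc _ _ _ le_rfl (by omega) hi hi').trans (by simp [wordC])

lemma toRAAG_clsA {i : ℕ} (hi : 1 ≤ i) (hi' : i ≤ 4) :
    toRAAG (clsA 2 i) = upperA clsV clsZ i :=
  (lift_ga _ _ _ (by omega) le_rfl hi hi').trans (by simp [wordA])

lemma toRAAG_clsB : toRAAG (clsB 1 1) = clsZ⁻¹ * upperA clsV clsZ 1 :=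
  (lift_gb _ _ _ le_rfl (by omega) le_rfl (by omega)).trans (by simp [wordB])

lemma toRAAG_comp_ofRAAG : toRAAG.comp ofRAAG = MonoidHom.id _ := by
  have hz : toRAAG (clsA 2 1 * (clsB 1 1)⁻¹) = clsZ := by
    rw [map_mul, map_inv, toRAAG_clsB, toRAAG_clsA le_rfl (by omega)]
    group
  refine PresentedGroup.ext ?_
  rintro (⟨k, i⟩ | ⟨⟩)
  · change toRAAG (ofRAAG (clsV k i)) = clsV k i
    rw [ofRAAG_clsV, map_vertexWord, hz,
      vertexWord_congr (c := toRAAG ∘ clsC 1) (a := toRAAG ∘ clsA 2) clsZ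
        (fun _ => toRAAG_clsC) (fun _ => toRAAG_clsA),
      vertexWord_lowerC_upperA]
  · change toRAAG (ofRAAG clsZ) = clsZ
    rw [ofRAAG_clsZ, hz]

end SquareBraid


/-- **Example.** `B(5,3)` is isomorphic to the RAAG of the graph `S_2` plus one isolated
vertex. -/
theorem B53_iso_RAAG_S2_plus_one :
    Nonempty (B 5 3 ≃* RAAG S2PlusOne) := by
  exact ⟨MonoidHom.toMulEquiv SquareBraid.toRAAG SquareBraid.ofRAAG
    SquareBraid.ofRAAG_comp_toRAAG SquareBraid.toRAAG_comp_ofRAAG⟩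
end
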